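/- arXiv:1504.04692 — 7 statements merged into one kernel-verified Lean document; each statement's English description precedes it below -/
import Mathlib

section
/- Let g : [0,∞) → ℝ be bounded and continuous, and suppose that (1/T)∫₀^T g(t) dt converges to a real number ℓ as T → +∞. Then (1/log(2+T)) ∫₀^T g(t)/(2+t) dt also converges to ℓ as T → +∞. -/
open MeasureTheory Filter

theorem hasDerivAt_log_two_add {t : ℝ} (ht : 0 ≤ t) :
    HasDerivAt (fun x : ℝ => Real.log (2 + x)) (2 + t)⁻¹ t := by
  simpa using ((hasDerivAt_id t).const_add 2).log (by simp only [id]; positivity)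

theorem continuousOn_inv_two_add {a b : ℝ} (ha : 0 ≤ a) (hb : 0 ≤ b) :
    ContinuousOn (fun t : ℝ => (2 + t)⁻¹) (Set.uIcc a b) := by
  refine ContinuousOn.inv₀ (by fun_prop) fun t ht => ?_
  have : 0 ≤ t := (le_min ha hb).trans ht.1
  positivity

theorem integral_inv_two_add {a b : ℝ} (ha : 0 ≤ a) (hb : 0 ≤ b) :
    ∫ t in a..b, (2 + t)⁻¹ = Real.log (2 + b) - Real.log (2 + a) :=
  intervalIntegral.integral_eq_sub_of_hasDerivAt
    (fun _ ht => hasDerivAt_log_two_add ((le_min ha hb).trans ht.1))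
    (continuousOn_inv_two_add ha hb).intervalIntegrable

theorem tendsto_log_two_add_atTop :
    Tendsto (fun T : ℝ => Real.log (2 + T)) atTop atTop :=
  Real.tendsto_log_atTop.comp (tendsto_atTop_add_const_left _ _ tendsto_id)

/-- Logarithmic averages of a function tending to zero are negligible. -/
theorem isLittleO_integral_mul_inv_two_add {k : ℝ → ℝ} (hk : ContinuousOn k (Set.Ici 0))
    (hlim : Tendsto k atTop (nhds 0)) :
    (fun T : ℝ => ∫ t in (0:ℝ)..T, k t * (2 + t)⁻¹) =o[atTop]
      fun T : ℝ => Real.log (2 + T) := by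
  have hint : ∀ {a b : ℝ}, 0 ≤ a → 0 ≤ b →
      IntervalIntegrable (fun t => k t * (2 + t)⁻¹) volume a b := fun ha hb =>
    ((hk.mono fun _ ht => (le_min ha hb).trans ht.1).mul
      (continuousOn_inv_two_add ha hb)).intervalIntegrable
  refine Asymptotics.isLittleO_iff.2 fun ε hε => ?_
  obtain ⟨S, hS⟩ := eventually_atTop.1
    ((hlim.eventually (Metric.closedBall_mem_nhds 0 (half_pos hε))).and (eventually_ge_atTop 0))
  have hS0 : 0 ≤ S := (hS S le_rfl).2
  filter_upwards [eventually_ge_atTop S, tendsto_log_two_add_atTop.eventually_ge_atTop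
    (|∫ t in (0:ℝ)..S, k t * (2 + t)⁻¹| / (ε / 2))] with T hST hT
  have hT0 : 0 ≤ T := hS0.trans hST
  have hlogS : 0 ≤ Real.log (2 + S) := Real.log_nonneg (by linarith)
  have hlogT : 0 ≤ Real.log (2 + T) := Real.log_nonneg (by linarith)
  have htail : |∫ t in S..T, k t * (2 + t)⁻¹| ≤ ∫ t in S..T, ε / 2 * (2 + t)⁻¹ := by
    rw [← Real.norm_eq_abs]
    refine intervalIntegral.norm_integral_le_of_norm_le hST (ae_of_all _ fun t ht => ?_)
      ((continuousOn_inv_two_add hS0 hT0).intervalIntegrable.const_mul _)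
    have ht0 : 0 ≤ t := hS0.trans ht.1.le
    have hkt : ‖k t‖ ≤ ε / 2 := by simpa using (hS t ht.1.le).1
    rw [norm_mul, Real.norm_of_nonneg (by positivity : 0 ≤ (2 + t)⁻¹)]
    gcongr
  rw [intervalIntegral.integral_const_mul, integral_inv_two_add hS0 hT0] at htail
  rw [div_le_iff₀ (half_pos hε)] at hT
  rw [Real.norm_eq_abs, Real.norm_of_nonneg hlogT,
    ← intervalIntegral.integral_add_adjacent_intervals (hint le_rfl hS0) (hint hS0 hT0)]
  refine (abs_add_le _ _).trans ?_
  nlinarith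

/-- Integration by parts against `1 / (2 + t)`. -/
theorem integral_mul_inv_two_add {g : ℝ → ℝ} (hg : Continuous g) {T : ℝ} (hT : 0 ≤ T) :
    ∫ t in (0:ℝ)..T, g t * (2 + t)⁻¹ = (∫ s in (0:ℝ)..T, g s) * (2 + T)⁻¹ +
      ∫ t in (0:ℝ)..T, (∫ s in (0:ℝ)..t, g s) * (2 + t)⁻¹ * (2 + t)⁻¹ := by
  have hnonneg : ∀ t ∈ Set.uIcc 0 T, 0 ≤ t := fun t ht => (le_min le_rfl hT).trans ht.1
  have hinv := continuousOn_inv_two_add le_rfl hT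
  have hparts := intervalIntegral.integral_mul_deriv_eq_deriv_mul
    (u := fun t => (2 + t)⁻¹) (u' := fun t => -((2 + t)⁻¹ * (2 + t)⁻¹))
    (v := fun t => ∫ s in (0:ℝ)..t, g s) (v' := g) (a := 0) (b := T)
    (fun t ht => by
      have := hnonneg t ht
      have h := ((hasDerivAt_id t).const_add 2).inv (by simp only [id]; positivity)
      refine h.congr_deriv ?_
      simp only [id]
      field_simp)
    (fun t _ => intervalIntegral.integral_hasDerivAt_right (hg.intervalIntegrable _ _)
      hg.aestronglyMeasurable.stronglyMeasurableAtFilter hg.continuousAt)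
    (hinv.mul hinv).neg.intervalIntegrable (hg.intervalIntegrable _ _)
  simp only [intervalIntegral.integral_same, mul_zero, sub_zero, neg_mul,
    intervalIntegral.integral_neg, sub_neg_eq_add] at hparts
  simp only [mul_comm (g _), hparts, mul_comm (∫ s in (0:ℝ)..T, g s)]
  congr 1
  refine intervalIntegral.integral_congr fun t _ => ?_
  ring

/-- Let `g : [0,∞) → ℝ` be bounded and continuous, and suppose that
`(1/T)∫₀^T g(t) dt → ℓ` as `T → +∞`. Then `(1/log(2+T)) ∫₀^T g(t)/(2+t) dt → ℓ`
as `T → +∞`. -/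
theorem cesaro_log_average (g : ℝ → ℝ) (ℓ : ℝ)
    (hcont : ContinuousOn g (Set.Ici 0))
    (hbdd : ∃ M : ℝ, ∀ t ∈ Set.Ici (0 : ℝ), |g t| ≤ M)
    (hlim : Tendsto (fun T : ℝ => (1 / T) * ∫ t in (0:ℝ)..T, g t) atTop (nhds ℓ)) :
    Tendsto (fun T : ℝ => (1 / Real.log (2 + T)) * ∫ t in (0:ℝ)..T, g t / (2 + t))
      atTop (nhds ℓ) := by
  set f : ℝ → ℝ := fun t => g (max t 0) with hf
  have hfc : Continuous f := hcont.comp_continuous (by fun_prop) fun t => le_max_right t 0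
  have hfg : ∀ {T : ℝ}, 0 ≤ T → Set.EqOn f g (Set.uIcc 0 T) := fun hT t ht => by
    simp [hf, max_eq_left ((le_min le_rfl hT).trans ht.1)]
  set h : ℝ → ℝ := fun t => (∫ s in (0:ℝ)..t, f s) * (2 + t)⁻¹ with hh
  have hhc : ContinuousOn h (Set.Ici 0) := by
    refine (intervalIntegral.continuous_primitive
      (fun a b => hfc.intervalIntegrable a b) 0).continuousOn.mul
      (ContinuousOn.inv₀ (by fun_prop) fun t (ht : 0 ≤ t) => by positivity)
  have hratio : Tendsto (fun T : ℝ => 1 - 2 * (2 + T)⁻¹) atTop (nhds 1) := by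
    simpa using ((tendsto_inv_atTop_zero.comp
      (tendsto_atTop_add_const_left atTop (2:ℝ) tendsto_id)).const_mul 2).const_sub 1
  have hhlim : Tendsto h atTop (nhds ℓ) := by
    have hprod := hlim.mul hratio
    rw [mul_one] at hprod
    refine hprod.congr' ?_
    filter_upwards [eventually_gt_atTop 0] with T hT
    simp only [hh, intervalIntegral.integral_congr (hfg hT.le)]
    field_simp
    ring
  have hsmall := isLittleO_integral_mul_inv_two_add (k := fun t => h t - ℓ)
    (hhc.sub continuousOn_const) (by simpa using hhlim.sub_const ℓ)
  have hfirst : Tendsto (fun T => (h T - ℓ * Real.log 2) / Real.log (2 + T)) atTop (nhds 0) :=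
    (hhlim.sub_const _).div_atTop tendsto_log_two_add_atTop
  have hsum := (hfirst.add hsmall.tendsto_div_nhds_zero).add_const ℓ
  simp only [zero_add] at hsum
  refine hsum.congr' ?_
  filter_upwards [eventually_ge_atTop 0] with T hT
  have hlog : Real.log (2 + T) ≠ 0 := (Real.log_pos (by linarith)).ne'
  have hgf : ∫ t in (0:ℝ)..T, g t / (2 + t) = ∫ t in (0:ℝ)..T, f t * (2 + t)⁻¹ :=
    intervalIntegral.integral_congr fun t ht => by
      simp only [hfg hT ht, div_eq_mul_inv]
  have hinv := continuousOn_inv_two_add le_rfl hT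
  have hsplit : ∫ t in (0:ℝ)..T, (h t - ℓ) * (2 + t)⁻¹ =
      (∫ t in (0:ℝ)..T, h t * (2 + t)⁻¹) - ℓ * (Real.log (2 + T) - Real.log 2) := by
    simp only [sub_mul]
    rw [intervalIntegral.integral_sub, intervalIntegral.integral_const_mul,
      integral_inv_two_add le_rfl hT, add_zero]
    · exact ((hhc.mono fun _ ht => (le_min le_rfl hT).trans ht.1).mul hinv).intervalIntegrable
    · exact hinv.intervalIntegrable.const_mul _
  rw [hgf, integral_mul_inv_two_add hfc hT, hsplit, ← add_div, div_add' _ _ _ hlog, one_div_mul_eq_div]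
  congr 1
  simp only [hh]
  ring
end

section
/- Let N ≥ 3 be an integer and let s be a real number with 1 < s < N/2. There exists a constant C > 0 (depending only on N and s) such that for every Schwartz function f : ℝ^N → ℂ and every R > 0, one has ∫_{|x| ≤ R} |f(x)|² dx ≤ C · R^{2s} · ‖f‖²_{Ḣ^s}. -/
open MeasureTheory
open scoped FourierTransform

section

variable {V : Type*} [NormedAddCommGroup V] [InnerProductSpace ℝ V] [FiniteDimensional ℝ V]

/-- A smooth splitting of a Schwartz function into a part supported in the ball of radius `2 * ρ`
and a part vanishing on the ball of radius `ρ`. -/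
theorem SchwartzMap.exists_add_eq_of_cutoff (F : SchwartzMap V ℂ) {ρ : ℝ} (hρ : 0 < ρ) :
    ∃ G H : SchwartzMap V ℂ, G + H = F ∧ (∀ ξ, ‖G ξ‖ ≤ ‖F ξ‖) ∧ (∀ ξ, ‖H ξ‖ ≤ ‖F ξ‖) ∧
      (∀ ξ ∉ Metric.ball 0 (2 * ρ), G ξ = 0) ∧ ∀ ξ ∈ Metric.closedBall 0 ρ, H ξ = 0 := by
  let χ : ContDiffBump (0 : V) := ⟨ρ, 2 * ρ, hρ, by linarith⟩
  have hχ : (χ : V → ℝ).HasTemperateGrowth :=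
    (χ.hasCompactSupport.toSchwartzMap χ.contDiff).hasTemperateGrowth
  have hG (ξ : V) : SchwartzMap.smulLeftCLM ℂ (χ : V → ℝ) F ξ = χ ξ • F ξ :=
    SchwartzMap.smulLeftCLM_apply_apply hχ F ξ
  have hH (ξ : V) : (F - SchwartzMap.smulLeftCLM ℂ (χ : V → ℝ) F) ξ = (1 - χ ξ) • F ξ := by
    rw [sub_apply, hG, sub_smul, one_smul]
  refine ⟨SchwartzMap.smulLeftCLM ℂ (χ : V → ℝ) F, F - SchwartzMap.smulLeftCLM ℂ (χ : V → ℝ) F,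
    add_sub_cancel _ _, fun ξ => ?_, fun ξ => ?_, fun ξ hξ => ?_, fun ξ hξ => ?_⟩
  · rw [hG, norm_smul, Real.norm_of_nonneg χ.nonneg]
    exact mul_le_of_le_one_left (norm_nonneg _) χ.le_one
  · rw [hH, norm_smul, Real.norm_of_nonneg (sub_nonneg.2 χ.le_one)]
    exact mul_le_of_le_one_left (norm_nonneg _) (sub_le_self _ χ.nonneg)
  · rw [hG, χ.zero_of_le_dist (by simpa using hξ), zero_smul]
  · rw [hH, χ.one_of_mem_closedBall hξ, sub_self, zero_smul]

variable [MeasurableSpace V] [BorelSpace V]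

theorem integrableOn_ball_norm_rpow_neg [Nontrivial V] {r : ℝ} (hr : r < Module.finrank ℝ V)
    (ρ : ℝ) :
    IntegrableOn (fun x : V => ‖x‖ ^ (-r)) (Metric.ball 0 ρ) := by
  refine (integrableOn_fun_norm_addHaar volume (f := fun y : ℝ => y ^ (-r))).2 ?_
  have hd : 0 < Module.finrank ℝ V := Module.finrank_pos
  have h : IntegrableOn (fun y : ℝ => y ^ ((Module.finrank ℝ V : ℝ) - 1 - r)) (Set.Ioo 0 ρ) := by
    rcases le_or_gt ρ 0 with h0 | h0
    · simp [Set.Ioo_eq_empty_of_le h0]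
    · exact (intervalIntegral.integrableOn_Ioo_rpow_iff h0).2 (by linarith)
  refine h.congr_fun (fun y hy => ?_) measurableSet_Ioo
  simp only [smul_eq_mul]
  rw [sub_eq_add_neg _ r, Real.rpow_add hy.1, ← Nat.cast_pred hd, Real.rpow_natCast]

theorem setIntegral_ball_norm_rpow (r : ℝ) {ρ : ℝ} (hρ : 0 < ρ) :
    ∫ x in Metric.ball (0 : V) ρ, ‖x‖ ^ r =
      ρ ^ (Module.finrank ℝ V + r) * ∫ x in Metric.ball (0 : V) 1, ‖x‖ ^ r := by
  have h := Measure.setIntegral_comp_smul_of_pos volume (fun x : V => ‖x‖ ^ r)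
    (Metric.ball 0 1) hρ
  simp only [smul_unitBall hρ.ne', Real.norm_of_nonneg hρ.le, norm_smul,
    Real.mul_rpow hρ.le (norm_nonneg _), integral_const_mul, smul_eq_mul] at h
  rw [Real.rpow_add hρ, Real.rpow_natCast, mul_assoc, h, mul_inv_cancel_left₀ (by positivity)]

theorem SchwartzMap.integrable_norm_rpow_mul_norm_sq (F : SchwartzMap V ℂ) {r : ℝ} (hr : 0 ≤ r) :
    Integrable (fun ξ : V => ‖ξ‖ ^ r * ‖F ξ‖ ^ 2) := by
  obtain ⟨n, hn⟩ := exists_nat_ge r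
  have hb : Integrable (fun ξ : V => ‖F.toBoundedContinuousFunction‖ *
      (‖ξ‖ ^ 0 * ‖F ξ‖ + ‖ξ‖ ^ n * ‖F ξ‖)) :=
    ((F.integrable_pow_mul volume 0).add (F.integrable_pow_mul volume n)).const_mul _
  have hc : Continuous fun ξ : V => ‖ξ‖ ^ r * ‖F ξ‖ ^ 2 :=
    (continuous_norm.rpow_const fun _ => Or.inr hr).mul (F.continuous.norm.pow 2)
  refine hb.mono' hc.aestronglyMeasurable (.of_forall fun ξ => ?_)
  rw [Real.norm_of_nonneg (by positivity)]
  have h1 : ‖ξ‖ ^ r ≤ ‖ξ‖ ^ 0 + ‖ξ‖ ^ n := by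
    rcases le_total ‖ξ‖ 1 with h | h
    · have := Real.rpow_le_one (norm_nonneg ξ) h hr
      have : 0 ≤ ‖ξ‖ ^ n := by positivity
      rw [pow_zero]; linarith
    · have := Real.rpow_le_rpow_of_exponent_le h hn
      rw [Real.rpow_natCast] at this
      rw [pow_zero]; linarith
  have h2 : ‖F ξ‖ ≤ ‖F.toBoundedContinuousFunction‖ :=
    F.toBoundedContinuousFunction.norm_coe_le_norm ξ
  calc ‖ξ‖ ^ r * ‖F ξ‖ ^ 2 ≤ (‖ξ‖ ^ 0 + ‖ξ‖ ^ n) * (‖F.toBoundedContinuousFunction‖ * ‖F ξ‖) := by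
        rw [sq]; gcongr
    _ = _ := by ring

/-- Cauchy–Schwarz against the weight `‖ξ‖ ^ s`. -/
theorem SchwartzMap.sq_setIntegral_ball_norm_le [Nontrivial V] (F : SchwartzMap V ℂ) {s : ℝ}
    (hs : 0 ≤ s) (hs' : 2 * s < Module.finrank ℝ V) (ρ : ℝ) :
    (∫ ξ in Metric.ball 0 ρ, ‖F ξ‖) ^ 2 ≤
      (∫ ξ in Metric.ball (0 : V) ρ, ‖ξ‖ ^ (-(2 * s))) * ∫ ξ, ‖ξ‖ ^ (2 * s) * ‖F ξ‖ ^ 2 := by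
  have hsq (t : ℝ) (ξ : V) : (‖ξ‖ ^ t) ^ 2 = ‖ξ‖ ^ (2 * t) := by
    rw [mul_comm, Real.rpow_mul (norm_nonneg ξ), Real.rpow_two]
  have hsqF (ξ : V) : (‖ξ‖ ^ s * ‖F ξ‖) ^ 2 = ‖ξ‖ ^ (2 * s) * ‖F ξ‖ ^ 2 := by
    rw [mul_pow, hsq]
  have hi := F.integrable_norm_rpow_mul_norm_sq (r := 2 * s) (by positivity)
  have hu : MemLp (fun ξ : V => ‖ξ‖ ^ (-s)) (ENNReal.ofReal 2)
      (volume.restrict (Metric.ball 0 ρ)) := by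
    rw [ENNReal.ofReal_ofNat, memLp_two_iff_integrable_sq
      (measurable_norm.pow_const _).aestronglyMeasurable]
    simpa only [hsq, mul_neg, IntegrableOn] using integrableOn_ball_norm_rpow_neg hs' ρ
  have hv : MemLp (fun ξ : V => ‖ξ‖ ^ s * ‖F ξ‖) (ENNReal.ofReal 2)
      (volume.restrict (Metric.ball 0 ρ)) := by
    rw [ENNReal.ofReal_ofNat, memLp_two_iff_integrable_sq]
    · simpa only [hsqF] using hi.restrict
    · exact ((continuous_norm.rpow_const fun _ => Or.inr hs).mul
        F.continuous.norm).aestronglyMeasurable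
  have hmul : ∫ ξ in Metric.ball 0 ρ, ‖F ξ‖ =
      ∫ ξ in Metric.ball 0 ρ, ‖ξ‖ ^ (-s) * (‖ξ‖ ^ s * ‖F ξ‖) := by
    refine integral_congr_ae (ae_restrict_of_ae ?_)
    filter_upwards [Measure.ae_ne volume (0 : V)] with ξ hξ
    rw [← mul_assoc, ← Real.rpow_add (norm_pos_iff.2 hξ), neg_add_cancel, Real.rpow_zero, one_mul]
  have hle := integral_mul_le_Lp_mul_Lq_of_nonneg Real.HolderConjugate.two_two
    (.of_forall fun ξ => by positivity) (.of_forall fun ξ => by positivity) hu hv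
  rw [← hmul] at hle
  simp only [Real.rpow_two, hsq, hsqF, mul_neg, ← Real.sqrt_eq_rpow] at hle
  calc (∫ ξ in Metric.ball 0 ρ, ‖F ξ‖) ^ 2
      ≤ (√(∫ ξ in Metric.ball (0 : V) ρ, ‖ξ‖ ^ (-(2 * s))) *
          √(∫ ξ in Metric.ball (0 : V) ρ, ‖ξ‖ ^ (2 * s) * ‖F ξ‖ ^ 2)) ^ 2 := by gcongr
    _ = (∫ ξ in Metric.ball (0 : V) ρ, ‖ξ‖ ^ (-(2 * s))) *
        ∫ ξ in Metric.ball (0 : V) ρ, ‖ξ‖ ^ (2 * s) * ‖F ξ‖ ^ 2 := by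
      rw [mul_pow, Real.sq_sqrt (integral_nonneg fun ξ => by positivity),
        Real.sq_sqrt (integral_nonneg fun ξ => by positivity)]
    _ ≤ _ := by
      refine mul_le_mul_of_nonneg_left ?_ (integral_nonneg fun ξ => by positivity)
      exact setIntegral_le_integral hi (.of_forall fun ξ => by positivity)

theorem SchwartzMap.integral_norm_sq_le_of_eq_zero_on_closedBall {F H : SchwartzMap V ℂ}
    {s ρ : ℝ} (hs : 0 ≤ s) (hρ : 0 < ρ) (hle : ∀ ξ, ‖H ξ‖ ≤ ‖F ξ‖)
    (hzero : ∀ ξ ∈ Metric.closedBall 0 ρ, H ξ = 0) :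
    ∫ ξ, ‖H ξ‖ ^ 2 ≤ ρ ^ (-(2 * s)) * ∫ ξ, ‖ξ‖ ^ (2 * s) * ‖F ξ‖ ^ 2 := by
  rw [← integral_const_mul]
  refine integral_mono_of_nonneg (.of_forall fun ξ => by positivity)
    ((F.integrable_norm_rpow_mul_norm_sq (by positivity)).const_mul _) (.of_forall fun ξ => ?_)
  by_cases hξ : ξ ∈ Metric.closedBall 0 ρ
  · simp only [hzero ξ hξ, norm_zero, zero_pow two_ne_zero]
    positivity
  · have hlt : ρ < ‖ξ‖ := by simpa using hξ
    have hone : 1 ≤ ρ ^ (-(2 * s)) * ‖ξ‖ ^ (2 * s) := by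
      rw [Real.rpow_neg hρ.le, ← div_eq_inv_mul, one_le_div (by positivity)]
      gcongr
    calc ‖H ξ‖ ^ 2 ≤ 1 * ‖F ξ‖ ^ 2 := by rw [one_mul]; gcongr; exact hle ξ
      _ ≤ ρ ^ (-(2 * s)) * ‖ξ‖ ^ (2 * s) * ‖F ξ‖ ^ 2 := by gcongr
      _ = _ := mul_assoc _ _ _

theorem SchwartzMap.norm_fourierInv_apply_le (G : SchwartzMap V ℂ) (x : V) :
    ‖𝓕⁻ G x‖ ≤ ∫ ξ, ‖G ξ‖ := by
  rw [SchwartzMap.fourierInv_coe, Real.fourierInv_eq]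
  exact (norm_integral_le_integral_norm _).trans_eq (by simp)

theorem SchwartzMap.integral_norm_sq_fourierInv (H : SchwartzMap V ℂ) :
    ∫ x, ‖𝓕⁻ H x‖ ^ 2 = ∫ ξ, ‖H ξ‖ ^ 2 := by
  rw [← SchwartzMap.integral_norm_sq_fourier, FourierTransform.fourier_fourierInv_eq]

theorem SchwartzMap.setIntegral_closedBall_norm_sq_le [Nontrivial V] (f : SchwartzMap V ℂ) {s R : ℝ}
    (hs : 0 ≤ s) (hs' : 2 * s < Module.finrank ℝ V) (hR : 0 < R) :
    ∫ x in Metric.closedBall 0 R, ‖f x‖ ^ 2 ≤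
      2 * (volume.real (Metric.ball (0 : V) 1) * (2 ^ (Module.finrank ℝ V - 2 * s) *
        ∫ ξ in Metric.ball (0 : V) 1, ‖ξ‖ ^ (-(2 * s))) + 1) * R ^ (2 * s) *
        ∫ ξ, ‖ξ‖ ^ (2 * s) * ‖𝓕 f ξ‖ ^ 2 := by
  obtain ⟨G, H, hsum, hG, hH, hG0, hH0⟩ := (𝓕 f).exists_add_eq_of_cutoff (inv_pos.2 hR)
  set d := Module.finrank ℝ V
  set K := ∫ ξ in Metric.ball (0 : V) 1, ‖ξ‖ ^ (-(2 * s))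
  set A := ∫ ξ, ‖ξ‖ ^ (2 * s) * ‖𝓕 f ξ‖ ^ 2
  have hf (x : V) : f x = 𝓕⁻ G x + 𝓕⁻ H x := by
    rw [← add_apply, ← FourierTransform.fourierInv_add, hsum,
      FourierTransform.fourierInv_fourier_eq]
  have hlow (x : V) : ‖𝓕⁻ G x‖ ^ 2 ≤ (2 * R⁻¹) ^ (d - 2 * s) * K * A := by
    have h1 : ‖𝓕⁻ G x‖ ≤ ∫ ξ in Metric.ball 0 (2 * R⁻¹), ‖𝓕 f ξ‖ := by
      refine (G.norm_fourierInv_apply_le x).trans ?_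
      rw [← setIntegral_eq_integral_of_forall_compl_eq_zero
        (s := Metric.ball 0 (2 * R⁻¹)) fun ξ hξ => by rw [hG0 ξ hξ, norm_zero]]
      exact integral_mono G.integrable.norm.integrableOn (𝓕 f).integrable.norm.integrableOn hG
    calc ‖𝓕⁻ G x‖ ^ 2 ≤ (∫ ξ in Metric.ball 0 (2 * R⁻¹), ‖𝓕 f ξ‖) ^ 2 := by gcongr
      _ ≤ _ := (𝓕 f).sq_setIntegral_ball_norm_le hs hs' _
      _ = _ := by rw [setIntegral_ball_norm_rpow _ (by positivity), ← sub_eq_add_neg]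
  have hhigh : ∫ x, ‖𝓕⁻ H x‖ ^ 2 ≤ R ^ (2 * s) * A := by
    rw [H.integral_norm_sq_fourierInv]
    refine (integral_norm_sq_le_of_eq_zero_on_closedBall hs (inv_pos.2 hR) hH hH0).trans_eq ?_
    rw [Real.inv_rpow hR.le, Real.rpow_neg hR.le, inv_inv]
  have hHi : Integrable (fun x => ‖𝓕⁻ H x‖ ^ 2) := by
    have h := (𝓕⁻ H).integrable_norm_rpow_mul_norm_sq (le_refl (0 : ℝ))
    simpa only [Real.rpow_zero, one_mul] using h
  have hci : IntegrableOn (fun _ : V => (2 * R⁻¹) ^ (d - 2 * s) * K * A)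
    (Metric.closedBall 0 R) := integrableOn_const measure_closedBall_lt_top.ne
  calc ∫ x in Metric.closedBall 0 R, ‖f x‖ ^ 2
      ≤ ∫ x in Metric.closedBall 0 R,
          2 * ((2 * R⁻¹) ^ (d - 2 * s) * K * A + ‖𝓕⁻ H x‖ ^ 2) := by
        refine integral_mono_of_nonneg (.of_forall fun x => by positivity)
          ((hci.add hHi.integrableOn).const_mul 2) (.of_forall fun x => ?_)
        simp only [hf]
        have h1 := norm_add_le (𝓕⁻ G x) (𝓕⁻ H x)
        have h2 : ‖𝓕⁻ G x + 𝓕⁻ H x‖ ^ 2 ≤ (‖𝓕⁻ G x‖ + ‖𝓕⁻ H x‖) ^ 2 := by gcongr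
        linarith [hlow x, add_sq_le (a := ‖𝓕⁻ G x‖) (b := ‖𝓕⁻ H x‖)]
    _ = 2 * (volume.real (Metric.closedBall (0 : V) R) * ((2 * R⁻¹) ^ (d - 2 * s) * K * A) +
          ∫ x in Metric.closedBall 0 R, ‖𝓕⁻ H x‖ ^ 2) := by
        rw [integral_const_mul, integral_add hci hHi.integrableOn, setIntegral_const, smul_eq_mul]
    _ ≤ 2 * (R ^ d * volume.real (Metric.ball (0 : V) 1) * ((2 * R⁻¹) ^ (d - 2 * s) * K * A) +
          R ^ (2 * s) * A) := by
        rw [Measure.addHaar_real_closedBall _ _ hR.le]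
        gcongr
        exact (setIntegral_le_integral hHi (.of_forall fun x => by positivity)).trans hhigh
    _ = _ := by
        rw [Real.mul_rpow zero_le_two (by positivity), Real.inv_rpow hR.le, ← Real.rpow_neg hR.le,
          neg_sub, Real.rpow_sub hR, Real.rpow_natCast]
        field_simp

end

/-- Let `N ≥ 3` and `1 < s < N/2`. There exists `C > 0` such that for every
Schwartz function `f : ℝ^N → ℂ` and every `R > 0`,
`∫_{|x| ≤ R} |f(x)|² dx ≤ C R^{2s} ‖f‖²_{Ḣ^s}`, where
`‖f‖²_{Ḣ^s} = ∫ |ξ|^{2s} |𝓕f(ξ)|² dξ`. -/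
theorem localized_mass_le_homogeneous_sobolev (N : ℕ) (hN : 3 ≤ N) (s : ℝ)
    (hs : 1 < s) (hs' : s < (N : ℝ) / 2) :
    ∃ C > (0 : ℝ), ∀ (f : SchwartzMap (EuclideanSpace ℝ (Fin N)) ℂ) (R : ℝ), 0 < R →
      (∫ x in Metric.closedBall (0 : EuclideanSpace ℝ (Fin N)) R, ‖f x‖ ^ 2)
        ≤ C * R ^ (2 * s) * ∫ ξ : EuclideanSpace ℝ (Fin N), ‖ξ‖ ^ (2 * s) * ‖𝓕 (⇑f) ξ‖ ^ 2 := by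
  have : Nonempty (Fin N) := ⟨⟨0, by omega⟩⟩
  refine ⟨_, ?_, fun f R hR => f.setIntegral_closedBall_norm_sq_le (by linarith)
    (by rw [finrank_euclideanSpace_fin]; linarith) hR⟩
  have : 0 ≤ ∫ ξ in Metric.ball (0 : EuclideanSpace ℝ (Fin N)) 1, ‖ξ‖ ^ (-(2 * s)) :=
    integral_nonneg fun ξ => by positivity
  positivity
end

section
/- Let N ≥ 3 be an integer and let s be a real number with 1 < s < N/2. There exists a constant C > 0 (depending only on N and s) such that for every Schwartz function f : ℝ^N → ℂ and every R > 0, one has ∫_{|x| ≤ R} |∇f(x)|² dx ≤ C · ‖f‖_{Ḣ^s}^{2/s} · ( ∫_{|x| ≤ 2R} |f(x)|² dx )^{1 − 1/s}. -/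
open MeasureTheory
open scoped FourierTransform ENNReal SchwartzMap LineDeriv

section WeightedConvolution

variable {V : Type*} [NormedAddCommGroup V] [InnerProductSpace ℝ V] [FiniteDimensional ℝ V]
  [MeasurableSpace V] [BorelSpace V]

/-- A weighted Schur test for convolution operators. -/
theorem lintegral_mul_conv_sq_le {k F w : V → ℝ≥0∞} (hk : Measurable k) (hF : Measurable F)
    (hw : Measurable w) (hw0 : ∀ᵐ η, w η ≠ 0) (hwt : ∀ η, w η ≠ ∞) {K : ℝ≥0∞}
    (hK : ∀ ξ, w ξ * ∫⁻ η, k (ξ - η) * (w η)⁻¹ ≤ K) :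
    ∫⁻ ξ, w ξ * (∫⁻ η, k (ξ - η) * F η) ^ 2 ≤ K * (∫⁻ ξ, k ξ) * ∫⁻ η, w η * F η ^ 2 := by
  have cauchy_schwarz (ξ : V) : (∫⁻ η, k (ξ - η) * F η) ^ 2 ≤
      (∫⁻ η, k (ξ - η) * (w η)⁻¹) * ∫⁻ η, k (ξ - η) * (w η * F η ^ 2) := by
    have h := ENNReal.lintegral_mul_norm_pow_le (μ := volume) (p := 1 / 2) (q := 1 / 2)
      (f := fun η ↦ k (ξ - η) * (w η)⁻¹) (g := fun η ↦ k (ξ - η) * (w η * F η ^ 2))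
      (by fun_prop) (by fun_prop) (by norm_num) (by norm_num) (by norm_num)
    have heq : ∫⁻ η, k (ξ - η) * F η = ∫⁻ η, (k (ξ - η) * (w η)⁻¹) ^ (1 / 2 : ℝ) *
        (k (ξ - η) * (w η * F η ^ 2)) ^ (1 / 2 : ℝ) := by
      refine lintegral_congr_ae ?_
      filter_upwards [hw0] with η hη
      rw [← ENNReal.mul_rpow_of_nonneg _ _ (by norm_num)]
      have : k (ξ - η) * (w η)⁻¹ * (k (ξ - η) * (w η * F η ^ 2)) = (k (ξ - η) * F η) ^ 2 := by
        calc _ = ((w η)⁻¹ * w η) * (k (ξ - η) * F η) ^ 2 := by ring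
          _ = _ := by rw [ENNReal.inv_mul_cancel hη (hwt η), one_mul]
      rw [this, ← ENNReal.rpow_natCast, ← ENNReal.rpow_mul]
      norm_num
    rw [heq]
    refine (pow_le_pow_left' h 2).trans_eq ?_
    rw [mul_pow, ← ENNReal.rpow_natCast, ← ENNReal.rpow_natCast, ← ENNReal.rpow_mul,
      ← ENNReal.rpow_mul]
    norm_num
  calc ∫⁻ ξ, w ξ * (∫⁻ η, k (ξ - η) * F η) ^ 2
      ≤ ∫⁻ ξ, K * ∫⁻ η, k (ξ - η) * (w η * F η ^ 2) := by
        refine lintegral_mono fun ξ ↦ ?_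
        calc _ ≤ w ξ * ((∫⁻ η, k (ξ - η) * (w η)⁻¹) * ∫⁻ η, k (ξ - η) * (w η * F η ^ 2)) := by
              gcongr; exact cauchy_schwarz ξ
          _ ≤ _ := by rw [← mul_assoc]; gcongr; exact hK ξ
    _ = K * ∫⁻ ξ, ∫⁻ η, k (ξ - η) * (w η * F η ^ 2) := by
        rw [lintegral_const_mul]
        exact Measurable.lintegral_prod_right (by fun_prop)
    _ = K * ∫⁻ η, ∫⁻ ξ, k (ξ - η) * (w η * F η ^ 2) := by
        rw [lintegral_lintegral_swap]
        exact Measurable.aemeasurable (by fun_prop)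
    _ = K * ∫⁻ η, (∫⁻ ξ, k ξ) * (w η * F η ^ 2) := by
        congr 1
        refine lintegral_congr fun η ↦ ?_
        rw [lintegral_mul_const _ (by fun_prop), lintegral_sub_right_eq_self k η]
    _ = _ := by rw [lintegral_const_mul _ (by fun_prop), mul_assoc]

theorem setLIntegral_ball_enorm_rpow_inv_lt_top {a : ℝ} (ha0 : 0 < a)
    (ha : a < Module.finrank ℝ V) :
    ∫⁻ η in Metric.ball (0 : V) 1, (‖η‖ₑ ^ a)⁻¹ < ∞ := by
  have hd : 0 < Module.finrank ℝ V := by exact_mod_cast ha0.trans ha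
  have : Nontrivial V := Module.nontrivial_of_finrank_pos (R := ℝ) hd
  have h : IntegrableOn (fun η : V ↦ ‖η‖ ^ (-a)) (Metric.ball 0 1) :=
    integrableOn_ball_of_norm_le_rpow hd (C := 1) ha
      (.of_forall fun x ↦ by rw [one_mul, Real.norm_of_nonneg (by positivity)])
      (Measurable.aestronglyMeasurable (by fun_prop))
  refine lt_of_eq_of_lt (lintegral_congr_ae ?_) h.2
  filter_upwards [ae_restrict_of_ae (Measure.ae_ne volume (0 : V))] with η hη
  rw [Real.enorm_of_nonneg (by positivity), ← ENNReal.ofReal_rpow_of_pos (norm_pos_iff.2 hη),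
    ofReal_norm, ENNReal.rpow_neg]

/-- Convolution of the singular weight `‖·‖ ^ (-a)` with a kernel decaying faster than
`‖·‖ ^ (-a)` decays like `‖·‖ ^ (-a)`. -/
theorem exists_enorm_rpow_mul_conv_le {a : ℝ} (ha1 : 1 ≤ a) (ha : a < Module.finrank ℝ V)
    {k : V → ℝ≥0∞} (hk : Measurable k) (hk1 : ∫⁻ ξ, k ξ ≠ ∞)
    (hka : ∫⁻ ξ, ‖ξ‖ₑ ^ a * k ξ ≠ ∞) {M : ℝ≥0∞} (hM : M ≠ ∞) (hkM : ∀ ξ, ‖ξ‖ₑ ^ a * k ξ ≤ M) :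
    ∃ K ≠ ∞, ∀ ξ : V, ‖ξ‖ₑ ^ a * ∫⁻ η, k (ξ - η) * (‖η‖ₑ ^ a)⁻¹ ≤ K := by
  have hd : 0 < Module.finrank ℝ V := by
    have : (0 : ℝ) < Module.finrank ℝ V := by linarith
    exact_mod_cast this
  have : Nontrivial V := Module.nontrivial_of_finrank_pos (R := ℝ) hd
  have hball := setLIntegral_ball_enorm_rpow_inv_lt_top (V := V) (by linarith) ha
  set J := ∫⁻ η in Metric.ball (0 : V) 1, (‖η‖ₑ ^ a)⁻¹
  set I := ∫⁻ ξ, ‖ξ‖ₑ ^ a * k ξ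
  refine ⟨2 ^ (a - 1) * (M * J + I + ∫⁻ ξ, k ξ), ?_, fun ξ ↦ ?_⟩
  · refine ENNReal.mul_ne_top (by simp) ?_
    simp [ENNReal.mul_ne_top hM hball.ne, hka, hk1]
  have split (η : V) : ‖ξ‖ₑ ^ a ≤ 2 ^ (a - 1) * (‖ξ - η‖ₑ ^ a + ‖η‖ₑ ^ a) := by
    refine le_trans ?_ (ENNReal.rpow_add_le_mul_rpow_add_rpow _ _ ha1)
    gcongr
    simpa using enorm_add_le (ξ - η) η
  have singular : ∫⁻ η, ‖ξ - η‖ₑ ^ a * k (ξ - η) * (‖η‖ₑ ^ a)⁻¹ ≤ M * J + I := by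
    rw [← lintegral_add_compl _ (measurableSet_ball (x := (0 : V)) (ε := 1))]
    gcongr
    · rw [← lintegral_const_mul _ (by fun_prop)]
      gcongr
      exact hkM _
    · calc _ ≤ ∫⁻ η in (Metric.ball (0 : V) 1)ᶜ, ‖ξ - η‖ₑ ^ a * k (ξ - η) := by
            refine setLIntegral_mono (by fun_prop) fun η hη ↦ mul_le_of_le_one_right' ?_
            rw [ENNReal.inv_le_one]
            refine ENNReal.one_le_rpow ?_ (by linarith)
            rw [← ofReal_norm, ENNReal.one_le_ofReal]
            simpa using hη
        _ ≤ ∫⁻ η, ‖ξ - η‖ₑ ^ a * k (ξ - η) := setLIntegral_le_lintegral _ _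
        _ = I := lintegral_sub_left_eq_self (fun ζ ↦ ‖ζ‖ₑ ^ a * k ζ) ξ
  have regular : ∫⁻ η, ‖η‖ₑ ^ a * (k (ξ - η) * (‖η‖ₑ ^ a)⁻¹) = ∫⁻ ξ, k ξ := by
    rw [← lintegral_sub_left_eq_self k ξ]
    refine lintegral_congr_ae ?_
    filter_upwards [Measure.ae_ne volume (0 : V)] with η hη
    rw [mul_left_comm, ENNReal.mul_inv_cancel, mul_one]
    · simp [hη]
    · simp; intro; linarith
  calc _ = ∫⁻ η, ‖ξ‖ₑ ^ a * (k (ξ - η) * (‖η‖ₑ ^ a)⁻¹) := by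
        rw [lintegral_const_mul _ (by fun_prop)]
    _ ≤ ∫⁻ η, 2 ^ (a - 1) * (‖ξ - η‖ₑ ^ a * k (ξ - η) * (‖η‖ₑ ^ a)⁻¹ +
          ‖η‖ₑ ^ a * (k (ξ - η) * (‖η‖ₑ ^ a)⁻¹)) := by
        refine lintegral_mono fun η ↦ ?_
        refine (mul_le_mul_left (split η) _).trans_eq ?_
        ring
    _ ≤ _ := by
        rw [lintegral_const_mul _ (by fun_prop), lintegral_add_left (by fun_prop), regular]
        gcongr

theorem lintegral_comp_smul_of_pos {g : V → ℝ≥0∞} (hg : Measurable g) {R : ℝ} (hR : 0 < R) :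
    ENNReal.ofReal (R ^ Module.finrank ℝ V) * ∫⁻ η, g (R • η) = ∫⁻ η, g η := by
  rw [← lintegral_map hg (measurable_const_smul R), Measure.map_addHaar_smul volume hR.ne',
    lintegral_smul_measure, smul_eq_mul, ← mul_assoc, ← ENNReal.ofReal_mul (by positivity),
    abs_of_pos (by positivity), mul_inv_cancel₀ (by positivity)]
  simp

/-- The bound of `exists_enorm_rpow_mul_conv_le` is invariant under `L¹`-normalized dilations of
the kernel. -/
theorem enorm_rpow_mul_conv_dilate_le {a : ℝ} (ha0 : 0 ≤ a) {k : V → ℝ≥0∞} (hk : Measurable k)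
    {K : ℝ≥0∞} (hK : ∀ ξ : V, ‖ξ‖ₑ ^ a * ∫⁻ η, k (ξ - η) * (‖η‖ₑ ^ a)⁻¹ ≤ K) {R : ℝ} (hR : 0 < R)
    (ξ : V) :
    ‖ξ‖ₑ ^ a * ∫⁻ η, ENNReal.ofReal (R ^ Module.finrank ℝ V) * k (R • (ξ - η)) * (‖η‖ₑ ^ a)⁻¹
      ≤ K := by
  refine le_of_eq_of_le ?_ (hK (R • ξ))
  rw [← lintegral_comp_smul_of_pos (g := fun η ↦ k (R • ξ - η) * (‖η‖ₑ ^ a)⁻¹) (by fun_prop) hR]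
  have hc0 : ‖R‖ₑ ^ a ≠ 0 := by simp [hR.ne']
  have hct : ‖R‖ₑ ^ a ≠ ∞ := by simp [ha0.not_gt]
  have : ∀ η, k (R • ξ - R • η) * (‖R • η‖ₑ ^ a)⁻¹ =
      (‖R‖ₑ ^ a)⁻¹ * (k (R • (ξ - η)) * (‖η‖ₑ ^ a)⁻¹) := by
    intro η
    rw [smul_sub, enorm_smul, ENNReal.mul_rpow_of_nonneg _ _ ha0,
      ENNReal.mul_inv (.inl hc0) (.inl hct)]
    ring
  simp_rw [this, mul_assoc]
  rw [lintegral_const_mul _ (by fun_prop), lintegral_const_mul _ (by fun_prop), enorm_smul,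
    ENNReal.mul_rpow_of_nonneg _ _ ha0]
  calc _ = (‖R‖ₑ ^ a * (‖R‖ₑ ^ a)⁻¹) * (‖ξ‖ₑ ^ a * (ENNReal.ofReal (R ^ Module.finrank ℝ V) *
        ∫⁻ η, k (R • (ξ - η)) * (‖η‖ₑ ^ a)⁻¹)) := by rw [ENNReal.mul_inv_cancel hc0 hct, one_mul]
    _ = _ := by ring

end WeightedConvolution

theorem rpow_le_one_add_pow_ceil {t a : ℝ} (ht : 0 ≤ t) (ha : 0 ≤ a) :
    t ^ a ≤ 1 + t ^ ⌈a⌉₊ := by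
  rcases le_total t 1 with h | h
  · exact (Real.rpow_le_one ht h ha).trans (by simp [pow_nonneg ht])
  · rw [← Real.rpow_natCast]
    exact (Real.rpow_le_rpow_of_exponent_le h (Nat.le_ceil a)).trans (by simp)

theorem SchwartzMap.exists_enorm_rpow_mul_le {V : Type*} [NormedAddCommGroup V] [NormedSpace ℝ V]
    (φ : 𝓢(V, ℂ)) {a : ℝ} (ha : 0 ≤ a) :
    ∃ M ≠ ∞, ∀ ξ, ‖ξ‖ₑ ^ a * ‖φ ξ‖ₑ ≤ M := by
  obtain ⟨C₀, hC₀⟩ := φ.decay' 0 0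
  obtain ⟨C₁, hC₁⟩ := φ.decay' ⌈a⌉₊ 0
  refine ⟨ENNReal.ofReal (C₀ + C₁), by simp, fun ξ ↦ ?_⟩
  rw [← ofReal_norm, ← ofReal_norm, ENNReal.ofReal_rpow_of_nonneg (by positivity) ha,
    ← ENNReal.ofReal_mul (by positivity)]
  refine ENNReal.ofReal_le_ofReal ?_
  have h₀ := hC₀ ξ
  have h₁ := hC₁ ξ
  simp only [norm_iteratedFDeriv_zero, pow_zero, one_mul] at h₀ h₁
  calc ‖ξ‖ ^ a * ‖φ ξ‖ ≤ (1 + ‖ξ‖ ^ ⌈a⌉₊) * ‖φ ξ‖ := by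
        gcongr
        exact rpow_le_one_add_pow_ceil (norm_nonneg ξ) ha
    _ ≤ C₀ + C₁ := by rw [add_mul, one_mul]; exact add_le_add h₀ h₁

section Schwartz

variable {V : Type*} [NormedAddCommGroup V] [InnerProductSpace ℝ V] [FiniteDimensional ℝ V]
  [MeasurableSpace V] [BorelSpace V]

theorem SchwartzMap.lintegral_enorm_rpow_mul_ne_top (φ : 𝓢(V, ℂ)) {a : ℝ} (ha : 0 ≤ a) :
    ∫⁻ ξ, ‖ξ‖ₑ ^ a * ‖φ ξ‖ₑ ≠ ∞ := by
  have h : Integrable fun ξ ↦ ‖φ ξ‖ + ‖ξ‖ ^ ⌈a⌉₊ * ‖φ ξ‖ :=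
    φ.integrable.norm.add (φ.integrable_pow_mul volume ⌈a⌉₊)
  refine (lt_of_le_of_lt (lintegral_mono fun ξ ↦ ?_) h.lintegral_lt_top).ne
  rw [← ofReal_norm, ← ofReal_norm, ENNReal.ofReal_rpow_of_nonneg (by positivity) ha,
    ← ENNReal.ofReal_mul (by positivity)]
  refine ENNReal.ofReal_le_ofReal ?_
  rw [← one_add_mul]
  gcongr
  exact rpow_le_one_add_pow_ceil (norm_nonneg ξ) ha

theorem SchwartzMap.lintegral_enorm_rpow_mul_sq_ne_top (φ : 𝓢(V, ℂ)) {a : ℝ} (ha : 0 ≤ a) :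
    ∫⁻ ξ, ‖ξ‖ₑ ^ a * ‖φ ξ‖ₑ ^ 2 ≠ ∞ := by
  obtain ⟨M, hM, hφM⟩ := φ.exists_enorm_rpow_mul_le le_rfl
  refine ne_top_of_le_ne_top (ENNReal.mul_ne_top (φ.lintegral_enorm_rpow_mul_ne_top ha) hM) ?_
  rw [← lintegral_mul_const' _ _ hM]
  refine lintegral_mono fun ξ ↦ ?_
  rw [sq, ← mul_assoc]
  gcongr
  simpa using hφM ξ

/-- The modulus of the Fourier transform of a product is at most the convolution of the moduli of
the Fourier transforms. -/
theorem SchwartzMap.enorm_fourier_pairing_mul_le (φ f : 𝓢(V, ℂ)) (ξ : V) :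
    ‖𝓕 (pairing (ContinuousLinearMap.mul ℂ ℂ) φ f) ξ‖ₑ ≤
      ∫⁻ η, ‖𝓕 φ (ξ - η)‖ₑ * ‖𝓕 f η‖ₑ := by
  have hinv (h : 𝓢(V, ℂ)) (x : V) : 𝓕⁻ h x = 𝓕 h (-x) := by
    rw [fourierInv_coe, Real.fourierInv_eq_fourier_neg, fourier_coe]
  have h : 𝓕 (pairing (ContinuousLinearMap.mul ℂ ℂ) φ f) ξ =
      convolution (ContinuousLinearMap.mul ℂ ℂ) (𝓕⁻ φ) (𝓕⁻ f) (-ξ) := by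
    have : convolution (ContinuousLinearMap.mul ℂ ℂ) (𝓕⁻ φ) (𝓕⁻ f) =
        𝓕⁻ (pairing (ContinuousLinearMap.mul ℂ ℂ) φ f) := by
      simp [convolution]
    rw [this, hinv, neg_neg]
  rw [h, convolution_apply, MeasureTheory.convolution_def]
  refine (enorm_integral_le_lintegral_enorm _).trans_eq ?_
  rw [← lintegral_sub_right_eq_self _ ξ]
  refine lintegral_congr fun η ↦ ?_
  simp [hinv]

theorem SchwartzMap.lintegral_enorm_sq_fourier (f : 𝓢(V, ℂ)) :
    ∫⁻ ξ, ‖𝓕 f ξ‖ₑ ^ 2 = ∫⁻ x, ‖f x‖ₑ ^ 2 := by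
  have h (g : 𝓢(V, ℂ)) : ∫⁻ x, ‖g x‖ₑ ^ 2 = ENNReal.ofReal (∫ x, ‖g x‖ ^ 2) := by
    rw [ofReal_integral_eq_lintegral_ofReal (by simpa using (g.memLp 2).integrable_norm_pow (by simp))
      (.of_forall fun _ ↦ by positivity)]
    simp [ENNReal.ofReal_pow]
  rw [h, h, integral_norm_sq_fourier]

theorem SchwartzMap.lintegral_enorm_sq_fderiv_apply (f : 𝓢(V, ℂ)) (m : V) :
    ∫⁻ x, ‖fderiv ℝ f x m‖ₑ ^ 2 =
      ENNReal.ofReal (2 * Real.pi) ^ 2 * ∫⁻ ξ, ‖inner ℝ ξ m‖ₑ ^ 2 * ‖𝓕 f ξ‖ₑ ^ 2 := by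
  have := (∂_{m} f).lintegral_enorm_sq_fourier
  simp only [lineDerivOp_apply_eq_fderiv] at this
  have htemp : (inner ℝ · m : V → ℝ).HasTemperateGrowth :=
    ((innerSL ℝ).flip m).hasTemperateGrowth
  rw [← this, fourier_lineDerivOp_eq, ← lintegral_const_mul _ (by fun_prop)]
  refine lintegral_congr fun ξ ↦ ?_
  simp only [smul_apply, smulLeftCLM_apply_apply htemp, enorm_smul, mul_pow]
  congr 2
  rw [← ofReal_norm]
  simp [abs_of_pos Real.pi_pos]

theorem fourier_comp_inv_smul (φ : V → ℂ) {R : ℝ} (hR : 0 < R) (ξ : V) :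
    𝓕 (fun x ↦ φ (R⁻¹ • x)) ξ = (R ^ Module.finrank ℝ V : ℝ) • 𝓕 φ (R • ξ) := by
  rw [Real.fourier_eq, Real.fourier_eq]
  have := Measure.integral_comp_inv_smul (volume : Measure V)
    (fun x ↦ Real.fourierChar (-(inner ℝ x (R • ξ))) • φ x) R
  rw [abs_of_pos (by positivity)] at this
  rw [← this]
  congr! 5 with x
  rw [inner_smul_left, inner_smul_right]
  simp [hR.ne']

/-- Multiplication by the dilates of a fixed Schwartz function is uniformly bounded on
`Ḣ^(a/2)`, when `a` is less than the dimension. -/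
theorem SchwartzMap.exists_lintegral_fourier_pairing_mul_le (φ : 𝓢(V, ℂ)) {a : ℝ} (ha1 : 1 ≤ a)
    (ha : a < Module.finrank ℝ V) :
    ∃ K ≠ ∞, ∀ R : ℝ, 0 < R → ∀ φR : 𝓢(V, ℂ), (∀ x, φR x = φ (R⁻¹ • x)) → ∀ f : 𝓢(V, ℂ),
      ∫⁻ ξ, ‖ξ‖ₑ ^ a * ‖𝓕 (pairing (ContinuousLinearMap.mul ℂ ℂ) φR f) ξ‖ₑ ^ 2 ≤
        K * ∫⁻ ξ, ‖ξ‖ₑ ^ a * ‖𝓕 f ξ‖ₑ ^ 2 := by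
  have ha0 : 0 < a := by linarith
  have hd : 0 < Module.finrank ℝ V := by exact_mod_cast ha0.trans ha
  have : Nontrivial V := Module.nontrivial_of_finrank_pos (R := ℝ) hd
  obtain ⟨M, hM, hkM⟩ := (𝓕 φ).exists_enorm_rpow_mul_le ha0.le
  have hk1 : ∫⁻ ξ, ‖𝓕 φ ξ‖ₑ ≠ ∞ := (𝓕 φ).integrable.2.ne
  obtain ⟨K, hKt, hK⟩ := exists_enorm_rpow_mul_conv_le ha1 ha (k := fun ξ ↦ ‖𝓕 φ ξ‖ₑ)
    (by fun_prop) hk1 ((𝓕 φ).lintegral_enorm_rpow_mul_ne_top ha0.le) hM hkM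
  refine ⟨K * ∫⁻ ξ, ‖𝓕 φ ξ‖ₑ, ENNReal.mul_ne_top hKt hk1, fun R hR φR hφR f ↦ ?_⟩
  have hkR (ξ : V) : ‖𝓕 φR ξ‖ₑ = ENNReal.ofReal (R ^ Module.finrank ℝ V) * ‖𝓕 φ (R • ξ)‖ₑ := by
    rw [fourier_coe, fourier_coe, show (φR : V → ℂ) = fun x ↦ φ (R⁻¹ • x) from funext hφR,
      fourier_comp_inv_smul _ hR, enorm_smul, Real.enorm_of_nonneg (by positivity)]
  have hL1 : ∫⁻ ξ, ‖𝓕 φR ξ‖ₑ = ∫⁻ ξ, ‖𝓕 φ ξ‖ₑ := by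
    simp_rw [hkR]
    rw [lintegral_const_mul' _ _ ENNReal.ofReal_ne_top,
      lintegral_comp_smul_of_pos (g := fun ξ ↦ ‖𝓕 φ ξ‖ₑ) (by fun_prop) hR]
  calc _ ≤ ∫⁻ ξ, ‖ξ‖ₑ ^ a * (∫⁻ η, ‖𝓕 φR (ξ - η)‖ₑ * ‖𝓕 f η‖ₑ) ^ 2 := by
        gcongr with ξ
        exact enorm_fourier_pairing_mul_le φR f ξ
    _ ≤ K * (∫⁻ ξ, ‖𝓕 φR ξ‖ₑ) * ∫⁻ ξ, ‖ξ‖ₑ ^ a * ‖𝓕 f ξ‖ₑ ^ 2 := by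
        refine lintegral_mul_conv_sq_le (k := fun ξ ↦ ‖𝓕 φR ξ‖ₑ) (F := fun ξ ↦ ‖𝓕 f ξ‖ₑ)
          (w := fun ξ ↦ ‖ξ‖ₑ ^ a) (by fun_prop) (by fun_prop) (by fun_prop) ?_ ?_ fun ξ ↦ ?_
        · filter_upwards [Measure.ae_ne volume (0 : V)] with η hη
          simp [hη]
        · simp [ha0.not_gt]
        · simp only [hkR]
          exact enorm_rpow_mul_conv_dilate_le ha0.le (k := fun ξ ↦ ‖𝓕 φ ξ‖ₑ) (by fun_prop) hK hR ξ
    _ = _ := by rw [hL1]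

/-- Interpolation of the gradient between `L²` and `Ḣ^s`. -/
theorem lintegral_enorm_sq_mul_le_rpow_mul_rpow {G : V → ℝ≥0∞} (hG : Measurable G) {s : ℝ}
    (hs : 1 ≤ s) :
    ∫⁻ ξ, ‖ξ‖ₑ ^ 2 * G ξ ≤
      (∫⁻ ξ, ‖ξ‖ₑ ^ (2 * s) * G ξ) ^ (1 / s) * (∫⁻ ξ, G ξ) ^ (1 - 1 / s) := by
  have hs0 : 0 < s := by linarith
  have h1s : 1 / s ≤ 1 := by rw [div_le_one hs0]; exact hs
  have h1s0 : 0 ≤ 1 / s := by positivity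
  refine le_of_eq_of_le (lintegral_congr fun ξ ↦ ?_) (ENNReal.lintegral_mul_norm_pow_le
    (f := fun ξ ↦ ‖ξ‖ₑ ^ (2 * s) * G ξ) (g := G) (by fun_prop) hG.aemeasurable h1s0
    (by linarith) (by ring))
  rw [ENNReal.mul_rpow_of_nonneg _ _ h1s0, ← ENNReal.rpow_mul, mul_assoc,
    ← ENNReal.rpow_add_of_nonneg _ _ h1s0 (by linarith)]
  have : 2 * s * (1 / s) = (2 : ℕ) := by field_simp; norm_num
  rw [this, ENNReal.rpow_natCast]
  simp

end Schwartz

section Cutoff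

variable (V : Type*) [NormedAddCommGroup V] [InnerProductSpace ℝ V] [FiniteDimensional ℝ V]

/-- A smooth cutoff function, equal to one near the closed unit ball and supported in the ball of
radius two. -/
theorem exists_schwartz_cutoff : ∃ φ : 𝓢(V, ℂ), (∀ x, ‖x‖ < 3 / 2 → φ x = 1) ∧
    (∀ x, ‖φ x‖ ≤ 1) ∧ ∀ x, 2 < ‖x‖ → φ x = 0 := by
  let b : ContDiffBump (0 : V) := ⟨3 / 2, 2, by norm_num, by norm_num⟩
  have hsupp : HasCompactSupport fun x ↦ (b x : ℂ) :=
    b.hasCompactSupport.comp_left (g := Complex.ofReal) rfl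
  have hsmooth : ContDiff ℝ (⊤ : ℕ∞) fun x ↦ (b x : ℂ) :=
    Complex.ofRealCLM.contDiff.comp b.contDiff
  refine ⟨hsupp.toSchwartzMap hsmooth, fun x hx ↦ ?_, fun x ↦ ?_, fun x hx ↦ ?_⟩
  · change (b x : ℂ) = 1
    rw [b.one_of_mem_closedBall (by simpa using hx.le), Complex.ofReal_one]
  · change ‖(b x : ℂ)‖ ≤ 1
    rw [Complex.norm_real, Real.norm_of_nonneg b.nonneg]
    exact b.le_one
  · change (b x : ℂ) = 0
    rw [b.zero_of_le_dist (by simpa using hx.le), Complex.ofReal_zero]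

end Cutoff

section Localization

variable {N : ℕ}

theorem SchwartzMap.lintegral_sum_enorm_sq_fderiv (f : 𝓢(EuclideanSpace ℝ (Fin N), ℂ)) :
    ∫⁻ x, ∑ i, ‖fderiv ℝ f x (EuclideanSpace.single i 1)‖ₑ ^ 2 =
      ENNReal.ofReal (2 * Real.pi) ^ 2 * ∫⁻ ξ, ‖ξ‖ₑ ^ 2 * ‖𝓕 f ξ‖ₑ ^ 2 := by
  rw [lintegral_finsetSum' _ fun i _ ↦
    ((∂_{EuclideanSpace.single i (1 : ℝ)} f).continuous.enorm.measurable.pow_const 2).aemeasurable]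
  simp_rw [lintegral_enorm_sq_fderiv_apply]
  rw [← Finset.mul_sum, ← lintegral_finsetSum' _ fun i _ ↦ Measurable.aemeasurable (by fun_prop)]
  congr 1
  refine lintegral_congr fun ξ ↦ ?_
  rw [← Finset.sum_mul]
  congr 1
  have hsq (t : ℝ) : ‖t‖ₑ ^ 2 = ENNReal.ofReal (t ^ 2) := by
    rw [← ofReal_norm, ← ENNReal.ofReal_pow (norm_nonneg t), Real.norm_eq_abs, sq_abs]
  rw [← enorm_norm ξ, hsq, EuclideanSpace.real_norm_sq_eq,
    ENNReal.ofReal_sum_of_nonneg fun _ _ ↦ sq_nonneg _]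
  refine Finset.sum_congr rfl fun i _ ↦ ?_
  rw [hsq, EuclideanSpace.inner_single_right]
  simp

/-- The localized interpolation inequality in terms of lower Lebesgue integrals. -/
theorem exists_setLIntegral_gradient_le {s : ℝ} (hs : 1 ≤ s) (hs' : 2 * s < N) :
    ∃ C ≠ ∞, ∀ (f : 𝓢(EuclideanSpace ℝ (Fin N), ℂ)) (R : ℝ), 0 < R →
      ∫⁻ x in Metric.closedBall 0 R, ∑ i, ‖fderiv ℝ f x (EuclideanSpace.single i 1)‖ₑ ^ 2 ≤
        C * (∫⁻ ξ, ‖ξ‖ₑ ^ (2 * s) * ‖𝓕 f ξ‖ₑ ^ 2) ^ (1 / s) *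
          (∫⁻ x in Metric.closedBall 0 (2 * R), ‖f x‖ₑ ^ 2) ^ (1 - 1 / s) := by
  have h1s0 : 0 ≤ 1 / s := by positivity
  have h1s : 0 ≤ 1 - 1 / s := by
    rw [sub_nonneg, div_le_one (by linarith)]
    exact hs
  obtain ⟨φ, hφ1, hφle, hφ0⟩ := exists_schwartz_cutoff (EuclideanSpace ℝ (Fin N))
  obtain ⟨K, hK, hφK⟩ := φ.exists_lintegral_fourier_pairing_mul_le (a := 2 * s) (by linarith)
    (by simpa using hs')
  refine ⟨ENNReal.ofReal (2 * Real.pi) ^ 2 * K ^ (1 / s),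
    ENNReal.mul_ne_top (ENNReal.pow_ne_top ENNReal.ofReal_ne_top)
      (ENNReal.rpow_ne_top_of_nonneg h1s0 hK), fun f R hR ↦ ?_⟩
  let φR : 𝓢(EuclideanSpace ℝ (Fin N), ℂ) := SchwartzMap.compCLMOfContinuousLinearEquiv ℝ
    (ContinuousLinearEquiv.smulLeft (Units.mk0 R⁻¹ (inv_ne_zero hR.ne'))) φ
  have hφR (x : EuclideanSpace ℝ (Fin N)) : φR x = φ (R⁻¹ • x) := rfl
  have hnorm (x : EuclideanSpace ℝ (Fin N)) : ‖R⁻¹ • x‖ = ‖x‖ / R := by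
    rw [norm_smul, Real.norm_of_nonneg (by positivity), inv_mul_eq_div]
  set g := SchwartzMap.pairing (ContinuousLinearMap.mul ℂ ℂ) φR f
  have hgapp (x : EuclideanSpace ℝ (Fin N)) : g x = φ (R⁻¹ • x) * f x := rfl
  have hfderiv : ∀ x ∈ Metric.closedBall (0 : EuclideanSpace ℝ (Fin N)) R,
      fderiv ℝ f x = fderiv ℝ g x := by
    intro x hx
    refine Filter.EventuallyEq.fderiv_eq ?_
    have hx' : x ∈ Metric.ball (0 : EuclideanSpace ℝ (Fin N)) (3 / 2 * R) := by
      rw [mem_closedBall_zero_iff] at hx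
      rw [mem_ball_zero_iff]
      linarith
    filter_upwards [Metric.isOpen_ball.mem_nhds hx'] with y hy
    rw [hgapp, hφ1, one_mul]
    rw [hnorm, div_lt_iff₀ hR]
    simpa using hy
  have hgL2 : ∫⁻ x, ‖g x‖ₑ ^ 2 ≤ ∫⁻ x in Metric.closedBall 0 (2 * R), ‖f x‖ₑ ^ 2 := by
    rw [← lintegral_indicator Metric.isClosed_closedBall.measurableSet]
    refine lintegral_mono fun x ↦ ?_
    by_cases hx : x ∈ Metric.closedBall (0 : EuclideanSpace ℝ (Fin N)) (2 * R)
    · rw [Set.indicator_of_mem hx, hgapp, enorm_mul]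
      gcongr
      refine mul_le_of_le_one_left' ?_
      rw [← ofReal_norm]
      exact ENNReal.ofReal_le_one.2 (hφle _)
    · rw [hgapp, hφ0]
      · simp
      · rw [hnorm, lt_div_iff₀ hR]
        simpa using hx
  calc _ = ∫⁻ x in Metric.closedBall 0 R,
          ∑ i, ‖fderiv ℝ g x (EuclideanSpace.single i 1)‖ₑ ^ 2 :=
        setLIntegral_congr_fun Metric.isClosed_closedBall.measurableSet fun x hx ↦ by
          simp only [hfderiv x hx]
    _ ≤ ∫⁻ x, ∑ i, ‖fderiv ℝ g x (EuclideanSpace.single i 1)‖ₑ ^ 2 := setLIntegral_le_lintegral _ _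
    _ = ENNReal.ofReal (2 * Real.pi) ^ 2 * ∫⁻ ξ, ‖ξ‖ₑ ^ 2 * ‖𝓕 g ξ‖ₑ ^ 2 :=
        g.lintegral_sum_enorm_sq_fderiv
    _ ≤ ENNReal.ofReal (2 * Real.pi) ^ 2 * ((∫⁻ ξ, ‖ξ‖ₑ ^ (2 * s) * ‖𝓕 g ξ‖ₑ ^ 2) ^ (1 / s) *
          (∫⁻ ξ, ‖𝓕 g ξ‖ₑ ^ 2) ^ (1 - 1 / s)) := by
        gcongr
        exact lintegral_enorm_sq_mul_le_rpow_mul_rpow (by fun_prop) hs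
    _ ≤ ENNReal.ofReal (2 * Real.pi) ^ 2 *
          ((K * ∫⁻ ξ, ‖ξ‖ₑ ^ (2 * s) * ‖𝓕 f ξ‖ₑ ^ 2) ^ (1 / s) *
          (∫⁻ x in Metric.closedBall 0 (2 * R), ‖f x‖ₑ ^ 2) ^ (1 - 1 / s)) := by
        rw [g.lintegral_enorm_sq_fourier]
        gcongr
        exact hφK R hR φR hφR f
    _ = _ := by
        rw [ENNReal.mul_rpow_of_nonneg _ _ h1s0]
        ring

end Localization

/-- Let `N ≥ 3` and `1 < s < N/2`. There exists `C > 0` such that for every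
Schwartz function `f : ℝ^N → ℂ` and every `R > 0`,
`∫_{|x| ≤ R} |∇f(x)|² dx ≤ C ‖f‖_{Ḣ^s}^{2/s} (∫_{|x| ≤ 2R} |f(x)|² dx)^{1 − 1/s}`,
where `‖f‖²_{Ḣ^s} = ∫ |ξ|^{2s} |𝓕f(ξ)|² dξ` and `|∇f|²` is the sum of the squared moduli
of the partial derivatives of `f`. -/
theorem localized_gradient_interpolation (N : ℕ) (hN : 3 ≤ N) (s : ℝ)
    (hs : 1 < s) (hs' : s < (N : ℝ) / 2) :
    ∃ C > (0 : ℝ), ∀ (f : SchwartzMap (EuclideanSpace ℝ (Fin N)) ℂ) (R : ℝ), 0 < R →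
      (∫ x in Metric.closedBall (0 : EuclideanSpace ℝ (Fin N)) R,
          ∑ i : Fin N, ‖fderiv ℝ (⇑f) x (EuclideanSpace.single i 1)‖ ^ 2)
        ≤ C * (∫ ξ : EuclideanSpace ℝ (Fin N), ‖ξ‖ ^ (2 * s) * ‖𝓕 (⇑f) ξ‖ ^ 2) ^ (1 / s) *
            (∫ x in Metric.closedBall (0 : EuclideanSpace ℝ (Fin N)) (2 * R),
              ‖f x‖ ^ 2) ^ (1 - 1 / s) := by
  have hs0 : 0 < s := by linarith
  have h1s : 1 / s ≤ 1 := by rw [div_le_one hs0]; exact hs.le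
  obtain ⟨C, hC, hle⟩ := exists_setLIntegral_gradient_le (N := N) hs.le (by linarith)
  refine ⟨C.toReal + 1, by positivity, fun f R hR ↦ ?_⟩
  have hgrad : ∫ x in Metric.closedBall (0 : EuclideanSpace ℝ (Fin N)) R,
        ∑ i : Fin N, ‖fderiv ℝ (⇑f) x (EuclideanSpace.single i 1)‖ ^ 2 =
      (∫⁻ x in Metric.closedBall 0 R,
        ∑ i, ‖fderiv ℝ f x (EuclideanSpace.single i 1)‖ₑ ^ 2).toReal := by
    rw [integral_eq_lintegral_of_nonneg_ae (.of_forall fun _ ↦ by positivity)]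
    · simp_rw [ENNReal.ofReal_sum_of_nonneg fun _ _ ↦ sq_nonneg _,
        ENNReal.ofReal_pow (norm_nonneg _), ofReal_norm]
    · exact (continuous_finsetSum _ fun i _ ↦
        (∂_{EuclideanSpace.single i (1 : ℝ)} f).continuous.norm.pow 2).aestronglyMeasurable
  have hhom : ∫ ξ : EuclideanSpace ℝ (Fin N), ‖ξ‖ ^ (2 * s) * ‖𝓕 (⇑f) ξ‖ ^ 2 =
      (∫⁻ ξ, ‖ξ‖ₑ ^ (2 * s) * ‖𝓕 f ξ‖ₑ ^ 2).toReal := by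
    rw [← SchwartzMap.fourier_coe, integral_eq_lintegral_of_nonneg_ae
      (.of_forall fun _ ↦ by positivity) (Measurable.aestronglyMeasurable (by fun_prop))]
    simp_rw [ENNReal.ofReal_mul (Real.rpow_nonneg (norm_nonneg _) _),
      ENNReal.ofReal_pow (norm_nonneg _),
      ← ENNReal.ofReal_rpow_of_nonneg (norm_nonneg _) (by positivity : 0 ≤ 2 * s), ofReal_norm]
  have hloc : ∫ x in Metric.closedBall (0 : EuclideanSpace ℝ (Fin N)) (2 * R), ‖f x‖ ^ 2 =
      (∫⁻ x in Metric.closedBall 0 (2 * R), ‖f x‖ₑ ^ 2).toReal := by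
    rw [integral_eq_lintegral_of_nonneg_ae (.of_forall fun _ ↦ by positivity)
      (Measurable.aestronglyMeasurable (by fun_prop))]
    simp_rw [ENNReal.ofReal_pow (norm_nonneg _), ofReal_norm]
  have hhom_ne : ∫⁻ ξ, ‖ξ‖ₑ ^ (2 * s) * ‖𝓕 f ξ‖ₑ ^ 2 ≠ ∞ :=
    (𝓕 f).lintegral_enorm_rpow_mul_sq_ne_top (by positivity)
  have hloc_ne : ∫⁻ x in Metric.closedBall 0 (2 * R), ‖f x‖ₑ ^ 2 ≠ ∞ := by
    refine ((setLIntegral_le_lintegral _ _).trans_lt ?_).ne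
    simpa using (f.lintegral_enorm_rpow_mul_sq_ne_top le_rfl).lt_top
  rw [hgrad, hhom, hloc, ENNReal.toReal_rpow, ENNReal.toReal_rpow]
  calc _ ≤ C.toReal * _ * _ := by
        rw [← ENNReal.toReal_mul, ← ENNReal.toReal_mul]
        refine ENNReal.toReal_mono ?_ (hle f R hR)
        exact ENNReal.mul_ne_top (ENNReal.mul_ne_top hC
          (ENNReal.rpow_ne_top_of_nonneg (by positivity) hhom_ne))
          (ENNReal.rpow_ne_top_of_nonneg (by linarith) hloc_ne)
    _ ≤ _ := by
        gcongr
        linarith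
end

section
/- Let N ≥ 3, let p > 1 be a real number, let I ⊂ ℝ be an open interval, and let u : I × ℝ^N → ℝ be a C² function solving ∂_t²u − Δu = |u|^{p−1}u pointwise on I × ℝ^N, such that there exists R₀ > 0 with supp u(t,·) ⊂ {|x| ≤ R₀} for every t ∈ I. Assume moreover that the energy vanishes: ½ ∫ |∇u(t,x)|² dx + ½ ∫ (∂_t u(t,x))² dx − (1/(p+1)) ∫ |u(t,x)|^{p+1} dx = 0 for all t ∈ I. Define y(t) = ∫_{ℝ^N} u(t,x)² dx. Then for all t ∈ I: (i) y''(t) = (p+3) ∫ (∂_t u(t,x))² dx + (p−1) ∫ |∇u(t,x)|² dx, and (ii) y'(t)² ≤ (4/(p+3)) · y(t) · y''(t). -/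
open MeasureTheory

noncomputable section

/-- Divergence of a vector field on `ℝ^N`; applied to the spatial gradient it gives
the spatial Laplacian. -/
def sdiv {N : ℕ} (F : EuclideanSpace ℝ (Fin N) → EuclideanSpace ℝ (Fin N))
    (y : EuclideanSpace ℝ (Fin N)) : ℝ :=
  ∑ i, fderiv ℝ (fun z => F z i) y (EuclideanSpace.single i 1)

end

theorem deriv_slice_eq_zero {E : Type*} {g : ℝ → E → ℝ} {I : Set ℝ} (hI : IsOpen I)
    {K : Set E} (hK : ∀ t ∈ I, Function.support (g t) ⊆ K)
    {t : ℝ} (ht : t ∈ I) {x : E} (hx : x ∉ K) :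
    deriv (fun σ => g σ x) t = 0 := by
  have h : (fun σ => g σ x) =ᶠ[nhds t] fun _ => 0 := by
    filter_upwards [hI.mem_nhds ht] with σ hσ
    exact Function.notMem_support.1 fun h => hx (hK σ hσ h)
  rw [h.deriv_eq, deriv_const]

section Slices

variable {E : Type*} [NormedAddCommGroup E] [NormedSpace ℝ E]

theorem ContDiffOn.differentiableAt_of_prod_univ {g : ℝ → E → ℝ} {I : Set ℝ} (hI : IsOpen I)
    (hg : ContDiffOn ℝ 1 (fun q : ℝ × E => g q.1 q.2) (I ×ˢ Set.univ)) {t : ℝ} (ht : t ∈ I)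
    (x : E) : DifferentiableAt ℝ (fun q : ℝ × E => g q.1 q.2) (t, x) :=
  (hg.contDiffAt ((hI.prod isOpen_univ).mem_nhds ⟨ht, Set.mem_univ x⟩)).differentiableAt
    one_ne_zero

theorem ContDiffOn.hasDerivAt_slice {g : ℝ → E → ℝ} {I : Set ℝ} (hI : IsOpen I)
    (hg : ContDiffOn ℝ 1 (fun q : ℝ × E => g q.1 q.2) (I ×ˢ Set.univ)) {t : ℝ} (ht : t ∈ I)
    (x : E) :
    HasDerivAt (fun σ => g σ x) (fderiv ℝ (fun q : ℝ × E => g q.1 q.2) (t, x) (1, 0)) t :=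
  HasFDerivAt.comp_hasDerivAt (l := fun q : ℝ × E => g q.1 q.2) (f := fun σ => (σ, x)) t
    (ContDiffOn.differentiableAt_of_prod_univ hI hg ht x).hasFDerivAt
    ((hasDerivAt_id t).prodMk (hasDerivAt_const t x))

theorem ContDiffOn.deriv_slice {n : WithTop ℕ∞} {g : ℝ → E → ℝ} {I : Set ℝ} (hI : IsOpen I)
    (hg : ContDiffOn ℝ (n + 1) (fun q : ℝ × E => g q.1 q.2) (I ×ˢ Set.univ)) :
    ContDiffOn ℝ n (fun q : ℝ × E => deriv (fun σ => g σ q.2) q.1) (I ×ˢ Set.univ) := by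
  have h := (hg.fderiv_of_isOpen (hI.prod isOpen_univ) le_rfl).clm_apply
    (contDiffOn_const (c := ((1 : ℝ), (0 : E))))
  refine h.congr fun q hq => ?_
  exact (ContDiffOn.hasDerivAt_slice hI (hg.of_le le_add_self) hq.1 q.2).deriv

theorem ContDiffOn.contDiff_slice {n : WithTop ℕ∞} {g : ℝ → E → ℝ} {I : Set ℝ}
    (hg : ContDiffOn ℝ n (fun q : ℝ × E => g q.1 q.2) (I ×ˢ Set.univ)) {t : ℝ} (ht : t ∈ I) :
    ContDiff ℝ n (g t) := by
  rw [← contDiffOn_univ]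
  exact hg.comp (contDiff_prodMk_right t).contDiffOn fun x _ => ⟨ht, Set.mem_univ x⟩

/-- Differentiation under the integral sign for a `C¹` function whose slices are supported in a
fixed compact set. -/
theorem ContDiffOn.hasDerivAt_integral [MeasurableSpace E] [BorelSpace E]
    {μ : Measure E} [IsFiniteMeasureOnCompacts μ]
    {g : ℝ → E → ℝ} {I : Set ℝ} (hI : IsOpen I)
    (hg : ContDiffOn ℝ 1 (fun q : ℝ × E => g q.1 q.2) (I ×ˢ Set.univ)) {K : Set E}
    (hKc : IsCompact K) (hK : ∀ t ∈ I, Function.support (g t) ⊆ K) {t : ℝ} (ht : t ∈ I) :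
    HasDerivAt (fun τ => ∫ x, g τ x ∂μ) (∫ x, deriv (fun σ => g σ x) t ∂μ) t := by
  have hg' : ContDiffOn ℝ 0 (fun q : ℝ × E => deriv (fun σ => g σ q.2) q.1) (I ×ˢ Set.univ) :=
    ContDiffOn.deriv_slice hI (by simpa using hg)
  have hint : ∀ {v : E → ℝ}, Continuous v → (∀ x ∉ K, v x = 0) → Integrable v μ :=
    fun hv h => hv.integrable_of_hasCompactSupport (HasCompactSupport.intro hKc h)
  have hzero : ∀ x ∉ K, g t x = 0 := fun x hx =>
    Function.notMem_support.1 fun h => hx (hK t ht h)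
  obtain ⟨ε, hε, hεI⟩ := Metric.nhds_basis_closedBall.mem_iff.1 (hI.mem_nhds ht)
  obtain ⟨C, hC⟩ := ((isCompact_closedBall t ε).prod hKc).exists_bound_of_continuousOn
    (hg'.continuousOn.mono (Set.prod_mono hεI (Set.subset_univ K)))
  refine (hasDerivAt_integral_of_dominated_loc_of_deriv_le (s := Metric.closedBall t ε)
    (F' := fun τ x => deriv (fun σ => g σ x) τ)
    (bound := K.indicator fun _ => C) (Metric.closedBall_mem_nhds t hε) ?_
    (hint (ContDiffOn.contDiff_slice hg ht).continuous hzero) ?_ ?_ ?_ ?_).2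
  · filter_upwards [hI.mem_nhds ht] with τ hτ
    have hz : ∀ x ∉ K, g τ x = 0 := fun x hx =>
      Function.notMem_support.1 fun h => hx (hK τ hτ h)
    exact (hint (ContDiffOn.contDiff_slice hg hτ).continuous hz).aestronglyMeasurable
  · exact (hint (ContDiffOn.contDiff_slice (g := fun τ x => deriv (fun σ => g σ x) τ) hg'
      ht).continuous fun x hx => deriv_slice_eq_zero hI hK ht hx).aestronglyMeasurable
  · refine .of_forall fun x τ hτ => ?_
    by_cases hx : x ∈ K
    · rw [Set.indicator_of_mem hx]
      exact hC (τ, x) ⟨hτ, hx⟩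
    · rw [Set.indicator_of_notMem hx, deriv_slice_eq_zero hI hK (hεI hτ) hx, norm_zero]
  · exact (integrable_indicator_iff hKc.measurableSet).2
      (integrableOn_const hKc.measure_lt_top.ne)
  · exact .of_forall fun x τ hτ =>
      (ContDiffOn.hasDerivAt_slice hI hg (hεI hτ) x).differentiableAt.hasDerivAt

end Slices

theorem sq_integral_mul_le {α : Type*} [MeasurableSpace α] {μ : Measure α} {f g : α → ℝ}
    (hff : Integrable (fun x => f x ^ 2) μ) (hfg : Integrable (fun x => f x * g x) μ)
    (hgg : Integrable (fun x => g x ^ 2) μ) :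
    (∫ x, f x * g x ∂μ) ^ 2 ≤ (∫ x, f x ^ 2 ∂μ) * ∫ x, g x ^ 2 ∂μ := by
  have h : ∀ a : ℝ, 0 ≤ (∫ x, f x ^ 2 ∂μ) * (a * a) + (2 * ∫ x, f x * g x ∂μ) * a
      + ∫ x, g x ^ 2 ∂μ := by
    intro a
    calc (0 : ℝ) ≤ ∫ x, (a * f x + g x) ^ 2 ∂μ := integral_nonneg fun x => sq_nonneg _
      _ = ∫ x, ((a * a) * f x ^ 2 + (2 * a) * (f x * g x) + g x ^ 2) ∂μ :=
        integral_congr_ae (.of_forall fun x => by ring)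
      _ = _ := by
        have hsum : Integrable (fun x => (a * a) * f x ^ 2 + (2 * a) * (f x * g x)) μ :=
          (hff.const_mul _).add (hfg.const_mul _)
        rw [integral_add hsum hgg,
          integral_add (hff.const_mul _) (hfg.const_mul _), integral_const_mul,
          integral_const_mul]
        ring
  have := discrim_le_zero h
  rw [discrim] at this
  linarith

theorem gradient_apply_eq_fderiv_single {N : ℕ} (v : EuclideanSpace ℝ (Fin N) → ℝ)
    (x : EuclideanSpace ℝ (Fin N)) (i : Fin N) :
    gradient v x i = fderiv ℝ v x (EuclideanSpace.single i 1) := by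
  rw [← inner_gradient_left, EuclideanSpace.inner_single_right]
  simp

/-- Green's identity for a compactly supported `C²` function. -/
theorem integral_mul_sdiv_gradient {N : ℕ} {v : EuclideanSpace ℝ (Fin N) → ℝ}
    (hv : ContDiff ℝ 2 v) (hc : HasCompactSupport v) :
    Integrable (fun x => v x * sdiv (fun z => gradient v z) x) ∧
    ∫ x, v x * sdiv (fun z => gradient v z) x = -∫ x, ‖gradient v x‖ ^ 2 := by
  have hd : ∀ i : Fin N,
      ContDiff ℝ 1 fun z => fderiv ℝ v z (EuclideanSpace.single i 1) := fun i =>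
    (hv.fderiv_right (m := 1) (by norm_num)).clm_apply contDiff_const
  have hdc : ∀ i : Fin N,
      HasCompactSupport fun z => fderiv ℝ v z (EuclideanSpace.single i 1) := fun i =>
    hc.fderiv_apply ℝ _
  have hdd : ∀ i : Fin N, Continuous fun x =>
      fderiv ℝ (fun z => fderiv ℝ v z (EuclideanSpace.single i 1)) x
        (EuclideanSpace.single i 1) := fun i =>
    ((hd i).continuous_fderiv one_ne_zero).clm_apply continuous_const
  have hint : ∀ i : Fin N, Integrable fun x =>
      v x * fderiv ℝ (fun z => fderiv ℝ v z (EuclideanSpace.single i 1)) x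
        (EuclideanSpace.single i 1) := fun i =>
    (hv.continuous.mul (hdd i)).integrable_of_hasCompactSupport hc.mul_right
  have hint' : ∀ i : Fin N, Integrable fun x =>
      fderiv ℝ v x (EuclideanSpace.single i 1) * fderiv ℝ v x (EuclideanSpace.single i 1) :=
    fun i => ((hd i).continuous.mul (hd i).continuous).integrable_of_hasCompactSupport
      (hdc i).mul_right
  have hsum : ∀ x, v x * sdiv (fun z => gradient v z) x = ∑ i : Fin N,
      v x * fderiv ℝ (fun z => fderiv ℝ v z (EuclideanSpace.single i 1)) x
        (EuclideanSpace.single i 1) := by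
    intro x
    simp only [sdiv, gradient_apply_eq_fderiv_single, Finset.mul_sum]
  have hnorm : ∀ x, ‖gradient v x‖ ^ 2 = ∑ i : Fin N,
      fderiv ℝ v x (EuclideanSpace.single i 1) * fderiv ℝ v x (EuclideanSpace.single i 1) := by
    intro x
    rw [EuclideanSpace.real_norm_sq_eq]
    simp only [gradient_apply_eq_fderiv_single, pow_two]
  simp only [hsum, hnorm]
  refine ⟨integrable_finsetSum _ fun i _ => hint i, ?_⟩
  rw [integral_finsetSum _ fun i _ => hint i, integral_finsetSum _ fun i _ => hint' i,
    ← Finset.sum_neg_distrib]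
  refine Finset.sum_congr rfl fun i _ => ?_
  exact integral_mul_fderiv_eq_neg_fderiv_mul_of_integrable (hint' i) (hint i)
    ((hv.continuous.mul (hd i).continuous).integrable_of_hasCompactSupport hc.mul_right)
    (fun x _ => hv.differentiable two_ne_zero x)
    (fun x _ => (hd i).differentiable one_ne_zero x)

/-- Let `N ≥ 3`, `p > 1`, `I` an open interval, and `u` a compactly
supported `C²` solution of `∂_t²u − Δu = |u|^{p−1}u` on `I × ℝ^N` with vanishing energy.
With `y(t) = ∫ u(t,x)² dx` (so that `y'(t) = 2∫ u ∂_t u`), for all `t ∈ I`: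
(i) `y''(t) = (p+3)∫(∂_t u)² + (p−1)∫|∇u|²`, and (ii) `y'(t)² ≤ (4/(p+3)) y(t) y''(t)`. -/
theorem virial_zero_energy (N : ℕ) (hN : 3 ≤ N) (p : ℝ) (hp : 1 < p)
    (I : Set ℝ) (hIopen : IsOpen I) (hIinterval : I.OrdConnected)
    (u : ℝ → EuclideanSpace ℝ (Fin N) → ℝ)
    (hreg : ContDiffOn ℝ 2 (fun q : ℝ × EuclideanSpace ℝ (Fin N) => u q.1 q.2)
      (I ×ˢ Set.univ))
    (R₀ : ℝ) (hR₀ : 0 < R₀)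
    (hsupp : ∀ t ∈ I, Function.support (u t) ⊆
      Metric.closedBall (0 : EuclideanSpace ℝ (Fin N)) R₀)
    (heq : ∀ t ∈ I, ∀ x : EuclideanSpace ℝ (Fin N),
      deriv (fun τ => deriv (fun σ => u σ x) τ) t - sdiv (fun z => gradient (u t) z) x
        = |u t x| ^ (p - 1) * u t x)
    (hE : ∀ t ∈ I,
      (1 / 2) * (∫ x : EuclideanSpace ℝ (Fin N), ‖gradient (u t) x‖ ^ 2)
        + (1 / 2) * (∫ x : EuclideanSpace ℝ (Fin N), (deriv (fun σ => u σ x) t) ^ 2)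
        - (1 / (p + 1)) * (∫ x : EuclideanSpace ℝ (Fin N), |u t x| ^ (p + 1)) = 0) :
    ∀ t ∈ I,
      HasDerivAt (fun τ =>
          2 * ∫ x : EuclideanSpace ℝ (Fin N), u τ x * deriv (fun σ => u σ x) τ)
        ((p + 3) * (∫ x : EuclideanSpace ℝ (Fin N), (deriv (fun σ => u σ x) t) ^ 2)
          + (p - 1) * ∫ x : EuclideanSpace ℝ (Fin N), ‖gradient (u t) x‖ ^ 2) t ∧
      (2 * ∫ x : EuclideanSpace ℝ (Fin N), u t x * deriv (fun σ => u σ x) t) ^ 2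
        ≤ 4 / (p + 3) * (∫ x : EuclideanSpace ℝ (Fin N), (u t x) ^ 2) *
            ((p + 3) * (∫ x : EuclideanSpace ℝ (Fin N), (deriv (fun σ => u σ x) t) ^ 2)
              + (p - 1) * ∫ x : EuclideanSpace ℝ (Fin N), ‖gradient (u t) x‖ ^ 2) := by
  intro t ht
  set K := Metric.closedBall (0 : EuclideanSpace ℝ (Fin N)) R₀
  have hK : IsCompact K := isCompact_closedBall _ _
  have hreg1 : ContDiffOn ℝ 1 (fun q : ℝ × EuclideanSpace ℝ (Fin N) => u q.1 q.2)
      (I ×ˢ Set.univ) := hreg.of_le one_le_two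
  have hut : ContDiffOn ℝ 1
      (fun q : ℝ × EuclideanSpace ℝ (Fin N) => deriv (fun σ => u σ q.2) q.1)
      (I ×ˢ Set.univ) := ContDiffOn.deriv_slice hIopen (by norm_num; exact hreg)
  have hv : ContDiff ℝ 2 (u t) := ContDiffOn.contDiff_slice hreg ht
  have hw : Continuous fun x => deriv (fun σ => u σ x) t :=
    (ContDiffOn.contDiff_slice (g := fun τ x => deriv (fun σ => u σ x) τ) hut ht).continuous
  have hvc : HasCompactSupport (u t) := HasCompactSupport.intro hK fun x hx =>
    Function.notMem_support.1 fun h => hx (hsupp t ht h)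
  have hwc : HasCompactSupport fun x => deriv (fun σ => u σ x) t :=
    HasCompactSupport.intro hK fun x hx => deriv_slice_eq_zero hIopen hsupp ht hx
  have hvv : Integrable fun x => u t x ^ 2 := by
    simp only [pow_two]
    exact (hv.continuous.mul hv.continuous).integrable_of_hasCompactSupport hvc.mul_right
  have hvw : Integrable fun x => u t x * deriv (fun σ => u σ x) t :=
    (hv.continuous.mul hw).integrable_of_hasCompactSupport hvc.mul_right
  have hww : Integrable fun x => deriv (fun σ => u σ x) t ^ 2 := by
    simp only [pow_two]
    exact (hw.mul hw).integrable_of_hasCompactSupport hwc.mul_right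
  have hpow : Integrable fun x => |u t x| ^ (p + 1) :=
    (hv.continuous.abs.rpow_const fun x => Or.inr (by linarith)).integrable_of_hasCompactSupport
      (hvc.comp_left (g := fun s => |s| ^ (p + 1))
        (by rw [abs_zero, Real.zero_rpow (by linarith)]))
  obtain ⟨hgreen_int, hgreen⟩ := integral_mul_sdiv_gradient hv hvc
  constructor
  · have hderiv := ContDiffOn.hasDerivAt_integral (μ := volume)
      (g := fun τ x => u τ x * deriv (fun σ => u σ x) τ) hIopen (hreg1.mul hut) hK
      (fun τ hτ => (Function.support_mul_subset_left _ _).trans (hsupp τ hτ)) ht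
    refine (hderiv.const_mul 2).congr_deriv ?_
    have hpt : ∀ x, deriv (fun τ => u τ x * deriv (fun σ => u σ x) τ) t =
        deriv (fun σ => u σ x) t ^ 2 + u t x * sdiv (fun z => gradient (u t) z) x
          + |u t x| ^ (p + 1) := by
      intro x
      have h1 := (ContDiffOn.hasDerivAt_slice hIopen hreg1 ht x).differentiableAt
      have h2 := (ContDiffOn.hasDerivAt_slice (g := fun τ x => deriv (fun σ => u σ x) τ)
        hIopen hut ht x).differentiableAt
      have h3 : |u t x| ^ (p + 1) = |u t x| ^ (p - 1) * (u t x * u t x) := by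
        rw [← abs_mul_abs_self, ← pow_two, ← Real.rpow_natCast,
          ← Real.rpow_add_of_nonneg (abs_nonneg _) (by linarith) (by positivity)]
        congr 1
        push_cast
        ring
      rw [(h1.hasDerivAt.fun_mul h2.hasDerivAt).deriv, h3]
      linear_combination u t x * heq t ht x
    simp only [hpt]
    have hsum : Integrable fun x =>
        deriv (fun σ => u σ x) t ^ 2 + u t x * sdiv (fun z => gradient (u t) z) x :=
      hww.add hgreen_int
    rw [integral_add hsum hpow, integral_add hww hgreen_int, hgreen]
    have hEt := hE t ht
    have hp1 : p + 1 ≠ 0 := by linarith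
    field_simp at hEt
    linear_combination -hEt
  · have hCS := sq_integral_mul_le hvv hvw hww
    have hA : 0 ≤ ∫ x, u t x ^ 2 := integral_nonneg fun x => sq_nonneg _
    have hG : 0 ≤ ∫ x, ‖gradient (u t) x‖ ^ 2 := integral_nonneg fun x => sq_nonneg _
    have hp3 : 0 < p + 3 := by linarith
    have hsplit : ∀ A B G : ℝ, 4 / (p + 3) * A * ((p + 3) * B + (p - 1) * G) =
        4 * (A * B) + 4 / (p + 3) * A * ((p - 1) * G) := by
      intro A B G
      field_simp
    rw [hsplit, mul_pow]
    have : 0 ≤ 4 / (p + 3) * (∫ x, u t x ^ 2) *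
        ((p - 1) * ∫ x, ‖gradient (u t) x‖ ^ 2) :=
      mul_nonneg (mul_nonneg (by positivity) hA) (mul_nonneg (by linarith) hG)
    linarith
end

section
/- Let k ∈ (0,1) and a ∈ ℝ. There is no twice differentiable function y : [a,∞) → ℝ such that for all t ≥ a one has y(t) > 0, y'(t) > 0, and y'(t)² ≤ k · y(t) · y''(t). -/
/-- Let `k ∈ (0,1)` and `a ∈ ℝ`. There is no twice differentiable
function `y : [a,∞) → ℝ` such that for all `t ≥ a` one has `y(t) > 0`, `y'(t) > 0`,
and `y'(t)² ≤ k y(t) y''(t)`. -/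
theorem no_global_convex_blowup (k a : ℝ) (hk : k ∈ Set.Ioo (0 : ℝ) 1) :
    ¬ ∃ y y' y'' : ℝ → ℝ,
      ∀ t ∈ Set.Ici a,
        HasDerivWithinAt y (y' t) (Set.Ici a) t ∧
        HasDerivWithinAt y' (y'' t) (Set.Ici a) t ∧
        0 < y t ∧ 0 < y' t ∧ (y' t) ^ 2 ≤ k * y t * y'' t := by
  rintro ⟨y, y', y'', h⟩
  obtain ⟨hk0, hk1⟩ := hk
  have hc : 0 < 1 / k - 1 := by
    rw [sub_pos, lt_div_iff₀ hk0]
    linarith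
  set c := 1 / k - 1 with hc_def
  have hderiv : ∀ t ∈ Set.Ici a, HasDerivWithinAt (fun s => y s / y' s + c * s)
      ((y' t * y' t - y t * y'' t) / y' t ^ 2 + c * 1) (Set.Ici a) t := fun t ht => by
    obtain ⟨hy, hy', -, hpos, -⟩ := h t ht
    exact (hy.div hy' hpos.ne').add ((hasDerivWithinAt_id t _).const_mul c)
  have hanti : AntitoneOn (fun s => y s / y' s + c * s) (Set.Ici a) := by
    refine antitoneOn_of_hasDerivWithinAt_nonpos (convex_Ici a)
      (fun t ht => (hderiv t ht).continuousWithinAt)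
      (fun t ht => (hderiv t (interior_subset ht)).mono interior_subset) fun t ht => ?_
    obtain ⟨-, -, -, hpos, hle⟩ := h t (interior_subset ht)
    have hquot : 1 / k ≤ y t * y'' t / y' t ^ 2 := by
      rw [div_le_div_iff₀ hk0 (by positivity)]
      linarith
    rw [sub_div, ← sq, div_self (by positivity)]
    linarith
  obtain ⟨-, -, hya, hya', -⟩ := h a Set.self_mem_Ici
  have hT : a + y a / y' a / c ∈ Set.Ici a := by
    rw [Set.mem_Ici, le_add_iff_nonneg_right]
    positivity
  obtain ⟨-, -, hyT, hyT', -⟩ := h _ hT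
  have hle := hanti Set.self_mem_Ici hT hT
  have hmul : c * (y a / y' a / c) = y a / y' a := mul_div_cancel₀ _ hc.ne'
  have hpos := div_pos hyT hyT'
  simp only [mul_add, hmul] at hle
  linarith
end

section
/- Let s > 1, T ∈ (0,∞), C > 0, α ∈ ℝ, and let V : (0,∞) × [0,T) → ℝ be a function such that: V(R,t) ≥ 0 for all R, t; for each R > 0 the function t ↦ V(R,t) is differentiable on [0,T) with |∂_t V(R,t)| ≤ (C/R) · V(4R,t)^{1 − 1/(2s)} for all t; and for each R > 0, V(R,t) → 0 as t → T⁻. If there exists C₁ > 0 such that V(R,t) ≤ C₁ R^{α} for all R > 0 and t ∈ [0,T), then there exists C₂ > 0 such that V(R,t) ≤ C₂ R^{α(1 − 1/(2s)) − 1} for all R > 0 and t ∈ [0,T). -/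
open Filter

/-- Abstract bootstrap step for the localized mass: if `V(R,t) ≥ 0`
satisfies `|∂_t V(R,t)| ≤ (C/R) V(4R,t)^{1−1/(2s)}`, `V(R,t) → 0` as `t → T⁻`, and
`V(R,t) ≤ C₁ R^α`, then `V(R,t) ≤ C₂ R^{α(1−1/(2s))−1}` for some `C₂ > 0`. -/
theorem localized_mass_bootstrap_step (s T C α : ℝ) (hs : 1 < s) (hT : 0 < T) (hC : 0 < C)
    (V V' : ℝ → ℝ → ℝ)
    (hnonneg : ∀ R > (0 : ℝ), ∀ t ∈ Set.Ico (0 : ℝ) T, 0 ≤ V R t)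
    (hderiv : ∀ R > (0 : ℝ), ∀ t ∈ Set.Ico (0 : ℝ) T,
      HasDerivWithinAt (V R) (V' R t) (Set.Ico (0 : ℝ) T) t)
    (hbound : ∀ R > (0 : ℝ), ∀ t ∈ Set.Ico (0 : ℝ) T,
      |V' R t| ≤ C / R * V (4 * R) t ^ (1 - 1 / (2 * s)))
    (hlim : ∀ R > (0 : ℝ), Tendsto (V R) (nhdsWithin T (Set.Iio T)) (nhds 0))
    (C₁ : ℝ) (hC₁ : 0 < C₁)
    (hV : ∀ R > (0 : ℝ), ∀ t ∈ Set.Ico (0 : ℝ) T, V R t ≤ C₁ * R ^ α) :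
    ∃ C₂ > (0 : ℝ), ∀ R > (0 : ℝ), ∀ t ∈ Set.Ico (0 : ℝ) T,
      V R t ≤ C₂ * R ^ (α * (1 - 1 / (2 * s)) - 1) := by
  set β : ℝ := 1 - 1 / (2 * s) with hβ_def
  have hβ : 0 ≤ β := by
    have : 1 / (2 * s) ≤ 1 := by
      rw [div_le_one (by linarith)]
      linarith
    linarith
  refine ⟨C * (C₁ * 4 ^ α) ^ β * T, by positivity, fun R hR t ht => ?_⟩
  have hrate : ∀ u ∈ Set.Ico (0 : ℝ) T,
      ‖V' R u‖ ≤ C * (C₁ * 4 ^ α) ^ β * R ^ (α * β - 1) := by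
    intro u hu
    have h4R : (0 : ℝ) < 4 * R := by linarith
    calc ‖V' R u‖ ≤ C / R * V (4 * R) u ^ β := hbound R hR u hu
      _ ≤ C / R * (C₁ * (4 * R) ^ α) ^ β := by
        gcongr
        · exact hnonneg _ h4R u hu
        · exact hV _ h4R u hu
      _ = C * (C₁ * 4 ^ α) ^ β * R ^ (α * β - 1) := by
        rw [Real.mul_rpow (by norm_num) hR.le, ← mul_assoc,
          Real.mul_rpow (by positivity) (by positivity), ← Real.rpow_mul hR.le,
          Real.rpow_sub_one hR.ne']
        ring
  set M : ℝ := C * (C₁ * 4 ^ α) ^ β * R ^ (α * β - 1) with hM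
  have hM0 : 0 ≤ M := by positivity
  have hincr : ∀ u ∈ Set.Ico (0 : ℝ) T, V R t - M * T ≤ V R u := by
    intro u hu
    have hlip := (convex_Ico (0 : ℝ) T).norm_image_sub_le_of_norm_hasDerivWithin_le
      (hderiv R hR) hrate hu ht
    have hdist : ‖t - u‖ ≤ T := by
      rw [Real.norm_eq_abs, abs_le]
      constructor <;> linarith [hu.1, hu.2, ht.1, ht.2]
    have hle : V R t - V R u ≤ M * T :=
      (le_abs_self _).trans (hlip.trans (mul_le_mul_of_nonneg_left hdist hM0))
    linarith
  have hzero : V R t - M * T ≤ 0 := by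
    refine ge_of_tendsto (hlim R hR) ?_
    filter_upwards [Ico_mem_nhdsLT hT] with u hu using hincr u hu
  calc V R t ≤ M * T := by linarith
    _ = C * (C₁ * 4 ^ α) ^ β * T * R ^ (α * β - 1) := by rw [hM]; ring
end

section
/- Let s > 1, T ∈ (0,∞), C > 0, and let V : (0,∞) × [0,T) → ℝ be a function such that: 0 ≤ V(R,t) ≤ C R^{2s} for all R > 0 and t ∈ [0,T); for each R > 0 the function t ↦ V(R,t) is differentiable on [0,T) with |∂_t V(R,t)| ≤ (C/R) · V(4R,t)^{1 − 1/(2s)} for all t; and for each R > 0, V(R,t) → 0 as t → T⁻. Then there exist β < 0 and C' > 0 such that V(R,t) ≤ C' R^{β} for all R > 0 and t ∈ [0,T). In particular, V(R,0) → 0 as R → ∞. -/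
open Filter

/-- A function on `[0, T)` whose derivative is bounded by `M` and which tends to `0` at `T`
is bounded by `M * T`. -/
theorem le_mul_of_abs_deriv_le_of_tendsto_zero {f f' : ℝ → ℝ} {T M : ℝ}
    (hderiv : ∀ t ∈ Set.Ico (0 : ℝ) T, HasDerivWithinAt f (f' t) (Set.Ico (0 : ℝ) T) t)
    (hbound : ∀ t ∈ Set.Ico (0 : ℝ) T, |f' t| ≤ M)
    (hlim : Tendsto f (nhdsWithin T (Set.Iio T)) (nhds 0)) {t : ℝ}
    (ht : t ∈ Set.Ico (0 : ℝ) T) : f t ≤ M * T := by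
  have hM : 0 ≤ M := (abs_nonneg _).trans (hbound t ht)
  have hlim' : Tendsto (fun u => f u + M * T) (nhdsWithin T (Set.Iio T)) (nhds (0 + M * T)) :=
    hlim.add_const _
  rw [zero_add] at hlim'
  refine ge_of_tendsto hlim' ?_
  filter_upwards [Ioo_mem_nhdsLT ht.2] with u hu
  have hu' : u ∈ Set.Ico (0 : ℝ) T := ⟨ht.1.trans hu.1.le, hu.2⟩
  have h := (convex_Ico (0 : ℝ) T).norm_image_sub_le_of_norm_hasDerivWithin_le
    hderiv hbound hu' ht
  rw [Real.norm_eq_abs, Real.norm_eq_abs] at h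
  have htu : |t - u| ≤ T := by
    rw [abs_le]
    constructor <;> linarith [hu.1, hu.2, ht.1, ht.2]
  have h1 := mul_le_mul_of_nonneg_left htu hM
  linarith [le_abs_self (f t - f u)]

/-- One step of the bootstrap: a power bound with exponent `α` improves to one with exponent
`α * θ - 1`. -/
theorem exists_rpow_bound_of_rpow_bound {T C θ α K : ℝ} (hT : 0 < T) (hC : 0 < C)
    (hθ : 0 ≤ θ) (hK : 0 < K) {V V' : ℝ → ℝ → ℝ}
    (hnonneg : ∀ R > (0 : ℝ), ∀ t ∈ Set.Ico (0 : ℝ) T, 0 ≤ V R t)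
    (hderiv : ∀ R > (0 : ℝ), ∀ t ∈ Set.Ico (0 : ℝ) T,
      HasDerivWithinAt (V R) (V' R t) (Set.Ico (0 : ℝ) T) t)
    (hbound : ∀ R > (0 : ℝ), ∀ t ∈ Set.Ico (0 : ℝ) T,
      |V' R t| ≤ C / R * V (4 * R) t ^ θ)
    (hlim : ∀ R > (0 : ℝ), Tendsto (V R) (nhdsWithin T (Set.Iio T)) (nhds 0))
    (hV : ∀ R > (0 : ℝ), ∀ t ∈ Set.Ico (0 : ℝ) T, V R t ≤ K * R ^ α) :
    ∃ K' > (0 : ℝ), ∀ R > (0 : ℝ), ∀ t ∈ Set.Ico (0 : ℝ) T,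
      V R t ≤ K' * R ^ (α * θ - 1) := by
  refine ⟨C * (K * 4 ^ α) ^ θ * T, by positivity, fun R hR t ht => ?_⟩
  have hM : ∀ u ∈ Set.Ico (0 : ℝ) T, |V' R u| ≤ C / R * (K * (4 * R) ^ α) ^ θ := by
    intro u hu
    have h4R : 0 < 4 * R := by positivity
    refine (hbound R hR u hu).trans (mul_le_mul_of_nonneg_left ?_ (by positivity))
    exact Real.rpow_le_rpow (hnonneg _ h4R u hu) (hV _ h4R u hu) hθ
  refine (le_mul_of_abs_deriv_le_of_tendsto_zero (hderiv R hR) hM (hlim R hR) ht).trans_eq ?_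
  rw [Real.mul_rpow (by norm_num) hR.le, ← mul_assoc,
    Real.mul_rpow (by positivity) (by positivity), ← Real.rpow_mul hR.le,
    Real.rpow_sub_one hR.ne']
  ring

/-- Abstract conclusion of the iterated bootstrap for the localized
mass: if `0 ≤ V(R,t) ≤ C R^{2s}`, `|∂_t V(R,t)| ≤ (C/R) V(4R,t)^{1−1/(2s)}` and
`V(R,t) → 0` as `t → T⁻`, then `V(R,t) ≤ C' R^β` for some `β < 0` and `C' > 0`;
in particular `V(R,0) → 0` as `R → ∞`. -/
theorem localized_mass_iterated_bootstrap (s T C : ℝ) (hs : 1 < s) (hT : 0 < T) (hC : 0 < C)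
    (V V' : ℝ → ℝ → ℝ)
    (hbdd : ∀ R > (0 : ℝ), ∀ t ∈ Set.Ico (0 : ℝ) T,
      0 ≤ V R t ∧ V R t ≤ C * R ^ (2 * s))
    (hderiv : ∀ R > (0 : ℝ), ∀ t ∈ Set.Ico (0 : ℝ) T,
      HasDerivWithinAt (V R) (V' R t) (Set.Ico (0 : ℝ) T) t)
    (hbound : ∀ R > (0 : ℝ), ∀ t ∈ Set.Ico (0 : ℝ) T,
      |V' R t| ≤ C / R * V (4 * R) t ^ (1 - 1 / (2 * s)))
    (hlim : ∀ R > (0 : ℝ), Tendsto (V R) (nhdsWithin T (Set.Iio T)) (nhds 0)) :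
    (∃ β < (0 : ℝ), ∃ C' > (0 : ℝ), ∀ R > (0 : ℝ), ∀ t ∈ Set.Ico (0 : ℝ) T,
      V R t ≤ C' * R ^ β) ∧
    Tendsto (fun R => V R 0) atTop (nhds 0) := by
  have hs0 : 0 < 2 * s := by linarith
  have hinv : 0 < 1 / (2 * s) := by positivity
  have hinv1 : 1 / (2 * s) < 1 := by
    rw [div_lt_one hs0]
    linarith
  have hiter : ∀ n : ℕ, ∃ K > (0 : ℝ), ∀ R > (0 : ℝ), ∀ t ∈ Set.Ico (0 : ℝ) T,
      V R t ≤ K * R ^ (4 * s * (1 - 1 / (2 * s)) ^ n - 2 * s) := by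
    intro n
    induction n with
    | zero =>
      refine ⟨C, hC, fun R hR t ht => (hbdd R hR t ht).2.trans_eq ?_⟩
      congr 2
      ring
    | succ n ih =>
      obtain ⟨K, hK, hV⟩ := ih
      have hexp : (4 * s * (1 - 1 / (2 * s)) ^ n - 2 * s) * (1 - 1 / (2 * s)) - 1 =
          4 * s * (1 - 1 / (2 * s)) ^ (n + 1) - 2 * s := by
        have h : 2 * s * (1 / (2 * s)) = 1 := mul_one_div_cancel hs0.ne'
        rw [pow_succ]
        linear_combination h
      rw [← hexp]
      exact exists_rpow_bound_of_rpow_bound hT hC (by linarith) hK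
        (fun R hR t ht => (hbdd R hR t ht).1) hderiv hbound hlim hV
  have hdecay : ∃ β < (0 : ℝ), ∃ C' > (0 : ℝ), ∀ R > (0 : ℝ), ∀ t ∈ Set.Ico (0 : ℝ) T,
      V R t ≤ C' * R ^ β := by
    obtain ⟨n, hn⟩ := exists_pow_lt_of_lt_one (show (0 : ℝ) < 1 / 2 by norm_num)
      (show 1 - 1 / (2 * s) < 1 by linarith)
    exact ⟨_, by nlinarith, hiter n⟩
  refine ⟨hdecay, ?_⟩
  obtain ⟨β, hβ, K, -, hV⟩ := hdecay
  have h0 : (0 : ℝ) ∈ Set.Ico (0 : ℝ) T := ⟨le_rfl, hT⟩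
  have hlim0 : Tendsto (fun R : ℝ => K * R ^ β) atTop (nhds 0) := by
    simpa using (tendsto_rpow_neg_atTop (neg_pos.mpr hβ)).const_mul K
  refine tendsto_of_tendsto_of_tendsto_of_le_of_le' tendsto_const_nhds hlim0 ?_ ?_
  · filter_upwards [eventually_gt_atTop 0] with R hR using (hbdd R hR 0 h0).1
  · filter_upwards [eventually_gt_atTop 0] with R hR using hV R hR 0 h0
end
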